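/- Fix an integer d ≥ 2 and a real c > c_d^*, and let t_c be the smallest root in (0,1) of t = e^{−c(1−t)^d}. Then limsup_{n→∞} E[dim ker ∂_d(Y_d(n, c/n))] / C(n,d) ≤ c·t_c·(1−t_c)^d + (c/(d+1))·(1−t_c)^{d+1} − (1−t_c). -/

import Mathlib

open Finset Filter
open scoped Classical

noncomputable section

/-- The set of all possible `d`-faces: `(d+1)`-element subsets of `[n]`. -/
def allFaces (n d : ℕ) : Finset (Finset (Fin n)) :=
  Finset.univ.filter (fun σ => σ.card = d + 1)

/-- Probability of the event `E` under `Y_d(n,p)`. -/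
def probY (n d : ℕ) (p : ℝ) (E : Finset (Finset (Fin n)) → Prop) : ℝ :=
  ∑ F ∈ (allFaces n d).powerset,
    if E F then p ^ F.card * (1 - p) ^ ((allFaces n d).card - F.card) else 0

/-- Expectation of `X` under `Y_d(n,p)`. -/
def expectY (n d : ℕ) (p : ℝ) (X : Finset (Finset (Fin n)) → ℝ) : ℝ :=
  ∑ F ∈ (allFaces n d).powerset,
    p ^ F.card * (1 - p) ^ ((allFaces n d).card - F.card) * X F

/-- Coefficient of the `d`-face `τ` in the boundary of `σ`. -/
def bdCoeff {n : ℕ} (τ σ : Finset (Fin n)) : ℝ :=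
  if τ ⊆ σ ∧ τ.card + 1 = σ.card then
    ∑ v ∈ σ \ τ, (-1 : ℝ) ^ (σ.filter (fun w => w < v)).card
  else 0

/-- The boundary operator `∂_d(F) : ℝ^F → ℝ^{(d-1)-faces}`. -/
def boundaryMap (n : ℕ) (F : Finset (Finset (Fin n))) :
    (↥F → ℝ) →ₗ[ℝ] (Finset (Fin n) → ℝ) where
  toFun x := fun τ => ∑ σ ∈ F.attach, x σ * bdCoeff τ σ.1
  map_add' x y := by
    funext τ
    simp [add_mul, Finset.sum_add_distrib]
  map_smul' c x := by
    funext τ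
    simp [Finset.mul_sum, mul_assoc]

/-- Dimension of the kernel of `∂_d(F)`, i.e. `dim H_d`. -/
def dimKer (n : ℕ) (F : Finset (Finset (Fin n))) : ℕ :=
  Module.finrank ℝ (LinearMap.ker (boundaryMap n F))

/-- The real shadow of `F`. -/
def shadowR (n d : ℕ) (F : Finset (Finset (Fin n))) : Finset (Finset (Fin n)) :=
  (allFaces n d).filter (fun σ => σ ∉ F ∧ dimKer n F < dimKer n (insert σ F))

/-- The `(d+2)`-subsets all of whose `(d+1)`-subsets are faces of `F`. -/
def simplexBoundaries (n d : ℕ) (F : Finset (Finset (Fin n))) : Finset (Finset (Fin n)) :=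
  Finset.univ.filter (fun τ => τ.card = d + 2 ∧ ∀ s ∈ τ.powerset, s.card = d + 1 → s ∈ F)

/-- The boundary cycle of the `(d+2)`-subset `τ`, as a vector in `ℝ^F`. -/
def simplexCycle (n : ℕ) (F : Finset (Finset (Fin n))) (τ : Finset (Fin n)) : ↥F → ℝ :=
  fun σ => bdCoeff σ.1 τ

namespace LP

/-- On `x = - log t`: the function `(1+d e^{-x}) x - (d+1)(1-e^{-x})`. -/
def HH (d : ℕ) (x : ℝ) : ℝ := (1 + d * Real.exp (-x)) * x - (d + 1) * (1 - Real.exp (-x))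

lemma HH_deriv (d : ℕ) (x : ℝ) :
    HasDerivAt (HH d) (Real.exp (-x) * (Real.exp x - 1 - d * x)) x := by
  have h1 : HasDerivAt (fun x : ℝ => Real.exp (-x)) (-Real.exp (-x)) x := by
    have := (hasDerivAt_neg x).exp
    simpa using this
  have h2 := (((h1.const_mul (d : ℝ)).const_add 1).mul (hasDerivAt_id x)).sub
    ((h1.const_sub 1).const_mul ((d : ℝ) + 1))
  refine (h2.congr_deriv ?_ : HasDerivAt (HH d) _ x)
  simp only [id]
  have : Real.exp (-x) * Real.exp x = 1 := by rw [← Real.exp_add]; simp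
  linear_combination -this

lemma slope_pos {d : ℕ} {x y : ℝ} (hx : 0 < x) (hxy : x ≤ y) (h : 0 ≤ Real.exp x - 1 - d * x) :
    0 ≤ Real.exp y - 1 - d * y := by
  have hy : 0 < y := hx.trans_le hxy
  have hc := convexOn_exp.2 (Set.mem_univ (0:ℝ)) (Set.mem_univ y)
    (sub_nonneg.mpr ((div_le_one hy).mpr hxy)) (show 0 ≤ x / y by positivity) (by ring)
  have e1 : (1 - x / y) • (0:ℝ) + (x / y) • y = x := by
    simp; field_simp
  rw [e1] at hc
  simp only [smul_eq_mul, Real.exp_zero] at hc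
  have h3 : (d : ℝ) * x ≤ (x / y) * (Real.exp y - 1) := by linarith
  have h4 : (x / y) * (d * y) = d * x := by field_simp
  have h5 : (x/y) * (d * y) ≤ (x / y) * (Real.exp y - 1) := by rw [h4]; exact h3
  have := le_of_mul_le_mul_left h5 (by positivity)
  linarith

lemma HH_mono {d : ℕ} {a b : ℝ} (ha : 0 < a) (hab : a ≤ b)
    (h : 0 ≤ Real.exp a - 1 - d * a) : HH d a ≤ HH d b := by
  have : MonotoneOn (HH d) (Set.Icc a b) := by
    apply monotoneOn_of_deriv_nonneg (convex_Icc a b)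
    · exact fun x _ => (HH_deriv d x).continuousAt.continuousWithinAt
    · exact fun x _ => (HH_deriv d x).differentiableAt.differentiableWithinAt
    · intro x hx
      rw [interior_Icc] at hx
      rw [(HH_deriv d x).deriv]
      exact mul_nonneg (Real.exp_pos _).le (slope_pos ha hx.1.le h)
  exact this (by simp [hab]) (by simp [hab]) hab

lemma HH_anti {d : ℕ} {b : ℝ} (hb : 0 < b)
    (h : Real.exp b - 1 - d * b < 0) : HH d b < 0 := by
  have h0 : HH d 0 = 0 := by simp [HH]
  have : StrictAntiOn (HH d) (Set.Icc 0 b) := by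
    apply strictAntiOn_of_deriv_neg (convex_Icc 0 b)
    · exact fun x _ => (HH_deriv d x).continuousAt.continuousWithinAt
    · intro x hx
      rw [interior_Icc] at hx
      rw [(HH_deriv d x).deriv]
      apply mul_neg_of_pos_of_neg (Real.exp_pos _)
      by_contra hcon
      push Not at hcon
      exact absurd (slope_pos hx.1 hx.2.le hcon) (not_le.mpr h)
  have := this (by simp [hb.le]) (by simp [hb.le]) hb
  linarith

/-- the value at a root -/
def gg (d : ℕ) (c t : ℝ) : ℝ :=
  c * t * (1 - t) ^ d + c / ((d : ℝ) + 1) * (1 - t) ^ (d + 1) - (1 - t)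

lemma gg_root {d : ℕ} {c t : ℝ} (ht : 0 < t) (h : t = Real.exp (-c * (1 - t) ^ d)) :
    (d + 1) * gg d c t = HH d (-Real.log t) := by
  have hl : Real.log t = -c * (1 - t) ^ d := by
    conv_lhs => rw [h]
    rw [Real.log_exp]
  unfold gg HH
  rw [neg_neg, Real.exp_log ht, pow_succ, hl]
  field_simp
  ring

theorem gg_le {d : ℕ} {c td tc : ℝ}
    (htd : td ∈ Set.Ioo (0 : ℝ) 1)
    (hroot : ((d : ℝ) + 1) * (1 - td) + (1 + (d : ℝ) * td) * Real.log td = 0)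
    (hc : c > -Real.log td / (1 - td) ^ d)
    (htc : tc ∈ Set.Ioo (0 : ℝ) 1)
    (htcroot : tc = Real.exp (-c * (1 - tc) ^ d))
    (htcmin : ∀ t ∈ Set.Ioo (0 : ℝ) 1, t = Real.exp (-c * (1 - t) ^ d) → tc ≤ t)
    {t : ℝ} (ht0 : 0 < t) (ht1 : t ≤ 1) (ht : t = Real.exp (-c * (1 - t) ^ d)) :
    gg d c t ≤ gg d c tc := by
  have hltd : 0 < -Real.log td := by
    have := Real.log_neg htd.1 htd.2; linarith
  have hHd : HH d (-Real.log td) = 0 := by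
    unfold HH
    rw [neg_neg, Real.exp_log htd.1]; linarith
  have hsl : 0 ≤ Real.exp (-Real.log td) - 1 - d * (-Real.log td) := by
    by_contra hcon
    push Not at hcon
    have := HH_anti hltd hcon
    linarith
  -- tc ≤ td
  have htctd : tc ≤ td := by
    have h1 : Real.exp (-c * (1 - td) ^ d) < td := by
      have hp : 0 < (1 - td) ^ d := pow_pos (by linarith [htd.2]) _
      rw [gt_iff_lt, div_lt_iff₀ hp] at hc
      calc _ < Real.exp (Real.log td) := Real.exp_lt_exp.mpr (by linarith)
        _ = td := Real.exp_log htd.1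
    have hcont : ContinuousOn (fun t : ℝ => Real.exp (-c * (1 - t) ^ d) - t) (Set.Icc 0 td) := by
      fun_prop
    have hz : (0:ℝ) ∈ Set.Icc ((fun t : ℝ => Real.exp (-c * (1 - t) ^ d) - t) td)
        ((fun t : ℝ => Real.exp (-c * (1 - t) ^ d) - t) 0) := by
      constructor
      · simp only; linarith
      · simp only [sub_zero]; exact (Real.exp_pos _).le
    obtain ⟨s, hs, hs0⟩ := intermediate_value_Icc' htd.1.le hcont hz
    simp only at hs0
    have hs0' : s = Real.exp (-c * (1 - s) ^ d) := by linarith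
    have hspos : 0 < s := by rw [hs0']; exact Real.exp_pos _
    have := htcmin s ⟨hspos, lt_of_le_of_lt hs.2 htd.2⟩ hs0'
    linarith [hs.2]
  have hlc : -Real.log td ≤ -Real.log tc := by
    have := Real.log_le_log htc.1 htctd; linarith
  have hHc : 0 ≤ HH d (-Real.log tc) := by
    rw [← hHd]; exact HH_mono hltd hlc hsl
  have hd1 : (0:ℝ) < d + 1 := by positivity
  have key : HH d (-Real.log t) ≤ HH d (-Real.log tc) := by
    rcases eq_or_lt_of_le ht1 with h1 | h1
    · subst h1; simpa [HH] using hHc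
    have hlt : 0 < -Real.log t := by
      have := Real.log_neg ht0 h1; linarith
    have htct : tc ≤ t := htcmin t ⟨ht0, h1⟩ ht
    have hl2 : -Real.log t ≤ -Real.log tc := by
      have := Real.log_le_log htc.1 htct; linarith
    by_cases hs : 0 ≤ Real.exp (-Real.log t) - 1 - d * (-Real.log t)
    · exact HH_mono hlt hl2 hs
    · push Not at hs
      exact (HH_anti hlt hs).le.trans hHc
  rw [← gg_root ht0 ht, ← gg_root htc.1 htcroot] at key
  exact le_of_mul_le_mul_left key hd1

end LP

namespace LP
open MeasureTheory ProbabilityTheory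
open scoped NNReal ENNReal

/-- node space -/
abbrev Om (d : ℕ) := List (ℕ × Fin d) → ℕ

def PP (d : ℕ) (c : ℝ≥0) : Measure (Om d) := Measure.infinitePi (fun _ => poissonMeasure c)

instance (d : ℕ) (c : ℝ≥0) : IsProbabilityMeasure (PP d c) := by unfold PP; infer_instance

def QQ (d : ℕ) (c : ℝ≥0) : Measure (ℕ × Fin d → Om d) := Measure.infinitePi (fun _ => PP d c)

instance (d : ℕ) (c : ℝ≥0) : IsProbabilityMeasure (QQ d c) := by unfold QQ; infer_instance

/-- glue a root value and subtrees -/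
def glue (d : ℕ) (x : ℕ × (ℕ × Fin d → Om d)) : Om d
  | [] => x.1
  | q :: l => x.2 q l

lemma measurable_glue (d : ℕ) : Measurable (glue d) := by
  rw [measurable_pi_iff]
  intro l
  cases l with
  | nil => exact measurable_fst
  | cons q l =>
    show Measurable (fun x : ℕ × (ℕ × Fin d → Om d) => x.2 q l)
    fun_prop

lemma glue_law (d : ℕ) (c : ℝ≥0) :
    ((poissonMeasure c).prod (QQ d c)).map (glue d) = PP d c := by
  unfold PP
  apply Measure.eq_infinitePi
  intro s t ht
  rw [Measure.map_apply (measurable_glue d) (.pi s.countable_toSet fun _ _ => ht _)]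
  -- curry
  have hcur := Measure.infinitePi_map_curry_symm
    (fun (_ : ℕ × Fin d) (_ : List (ℕ × Fin d)) => poissonMeasure c)
  have hinj : Function.Injective
      (fun p : (ℕ × Fin d) × List (ℕ × Fin d) => p.1 :: p.2) := by
    rintro ⟨a, b⟩ ⟨a', b'⟩ h
    simpa using h
  set s' := s.preimage (fun p : (ℕ × Fin d) × List (ℕ × Fin d) => p.1 :: p.2) hinj.injOn with hs'
  have e1 : glue d ⁻¹' (Set.pi s t) =
      ({k | [] ∈ s → k ∈ t []} : Set ℕ) ×ˢ
      ((MeasurableEquiv.curry (ℕ × Fin d) (List (ℕ × Fin d)) ℕ).symm ⁻¹'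
        (Set.pi (s' : Set ((ℕ × Fin d) × List (ℕ × Fin d))) (fun p => t (p.1 :: p.2)))) := by
    ext ⟨k, g⟩
    simp only [Set.mem_preimage, Set.mem_pi, Set.mem_prod, Set.mem_ofPred_eq, Finset.mem_coe]
    constructor
    · intro h
      refine ⟨fun h0 => h [] h0, fun p hp => ?_⟩
      have hp' : p.1 :: p.2 ∈ s := by simpa [hs'] using hp
      exact h _ hp'
    · rintro ⟨h1, h2⟩ l hl
      cases l with
      | nil => exact h1 hl
      | cons q l => exact h2 (q, l) (by simpa [hs'] using hl)
  rw [e1, Measure.prod_prod]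
  have e2 : QQ d c ((MeasurableEquiv.curry (ℕ × Fin d) (List (ℕ × Fin d)) ℕ).symm ⁻¹'
        (Set.pi (s' : Set ((ℕ × Fin d) × List (ℕ × Fin d))) (fun p => t (p.1 :: p.2)))) =
        ∏ p ∈ s', poissonMeasure c (t (p.1 :: p.2)) := by
    rw [← Measure.map_apply (MeasurableEquiv.measurable _)
      (.pi s'.countable_toSet fun _ _ => ht _)]
    unfold QQ PP
    rw [hcur, Measure.infinitePi_pi _ (fun _ _ => ht _)]
  rw [e2]
  have e3 : ∏ p ∈ s', poissonMeasure c (t (p.1 :: p.2)) =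
      ∏ l ∈ s.filter (fun l => l ≠ []), poissonMeasure c (t l) := by
    refine Finset.prod_bij (fun p _ => p.1 :: p.2) ?_ ?_ ?_ ?_
    · intro p hp; simpa [hs'] using hp
    · intro p _ q _ h; exact hinj h
    · intro l hl
      simp only [Finset.mem_filter] at hl
      cases l with
      | nil => exact absurd rfl hl.2
      | cons q l => exact ⟨(q, l), by simpa [hs'] using hl.1, rfl⟩
    · intros; rfl
  rw [e3, ← Finset.prod_filter_mul_prod_filter_not s (fun l => l ≠ []), mul_comm]
  congr 1
  by_cases h0 : [] ∈ s
  · have : s.filter (fun l => ¬ l ≠ []) = {[]} := by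
      ext l; simp only [ne_eq, not_not, Finset.mem_filter, Finset.mem_singleton]
      constructor
      · exact fun h => h.2
      · rintro rfl; exact ⟨h0, rfl⟩
    rw [this]; simp [h0]
  · have : s.filter (fun l => ¬ l ≠ []) = ∅ := by
      ext l; simp only [ne_eq, not_not, Finset.mem_filter, Finset.notMem_empty, iff_false]
      rintro ⟨h, rfl⟩; exact h0 h
    rw [this]; simp [h0]

/-- poisson weights -/
def pw (c : ℝ≥0) (m : ℕ) : ℝ≥0∞ := ENNReal.ofReal (Real.exp (-c) * c ^ m / m.factorial)

lemma lintegral_poisson (c : ℝ≥0) (f : ℕ → ℝ≥0∞) :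
    ∫⁻ k, f k ∂(poissonMeasure c) = ∑' m, pw c m * f m := by
  rw [lintegral_countable']
  simp_rw [poissonMeasure_singleton, pw, mul_comm]

lemma lintegral_PP (d : ℕ) (c : ℝ≥0) (f : Om d → ℝ≥0∞) (hf : Measurable f) :
    ∫⁻ ω, f ω ∂(PP d c) = ∑' m, pw c m * ∫⁻ g, f (glue d (m, g)) ∂(QQ d c) := by
  rw [← glue_law, lintegral_map hf (measurable_glue d),
    lintegral_prod (fun z => f (glue d z)) (hf.comp (measurable_glue d)).aemeasurable,
    lintegral_poisson]

/-- approximations of the fixed point -/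
def Hr (d : ℕ) : ℕ → Om d → ℝ≥0∞
  | 0 => fun _ => 1
  | r + 1 => fun ω => (1 + ∑ i ∈ Finset.range (ω []),
      (∑ j : Fin d, Hr d r (fun l => ω ((i, j) :: l)))⁻¹)⁻¹

lemma measurable_sum_range {α : Type*} [MeasurableSpace α] (N : α → ℕ) (hN : Measurable N)
    (f : ℕ → α → ℝ≥0∞) (hf : ∀ i, Measurable (f i)) :
    Measurable (fun a => ∑ i ∈ Finset.range (N a), f i a) := by
  have : Measurable (fun p : α × ℕ => ∑ i ∈ Finset.range p.2, f i p.1) := by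
    apply measurable_from_prod_countable_left
    intro m
    simp only
    exact Finset.measurable_fun_sum _ (fun i _ => hf i)
  exact this.comp (measurable_id.prodMk hN)

lemma measurable_Hr (d r : ℕ) : Measurable (Hr d r) := by
  induction r with
  | zero => exact measurable_const
  | succ r ih =>
    unfold Hr
    refine (Measurable.const_add ?_ 1).inv
    refine measurable_sum_range _ (by fun_prop) _ (fun i => ?_)
    refine (Finset.measurable_fun_sum _ (fun j _ => ?_)).inv
    exact ih.comp (by fun_prop)

lemma Hr_le_one (d r : ℕ) (ω : Om d) : Hr d r ω ≤ 1 := by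
  cases r with
  | zero => exact le_rfl
  | succ r =>
    unfold Hr
    rw [ENNReal.inv_le_one]; exact le_self_add

lemma Hr_anti (d r : ℕ) : ∀ ω : Om d, Hr d (r + 1) ω ≤ Hr d r ω := by
  induction r with
  | zero => intro ω; exact Hr_le_one _ _ _
  | succ r ih =>
    intro ω
    show (1 + ∑ i ∈ Finset.range (ω []),
      (∑ j : Fin d, Hr d (r + 1) (fun l => ω ((i, j) :: l)))⁻¹)⁻¹ ≤ (1 + ∑ i ∈ Finset.range (ω []),
      (∑ j : Fin d, Hr d r (fun l => ω ((i, j) :: l)))⁻¹)⁻¹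
    refine ENNReal.inv_le_inv.mpr (add_le_add le_rfl (Finset.sum_le_sum fun i _ => ?_))
    exact ENNReal.inv_le_inv.mpr (Finset.sum_le_sum fun j _ => ih _)

def HL (d : ℕ) (ω : Om d) : ℝ≥0∞ := ⨅ r, Hr d r ω

lemma measurable_HL (d : ℕ) : Measurable (HL d) := Measurable.iInf (measurable_Hr d)

lemma HL_le_one (d : ℕ) (ω : Om d) : HL d ω ≤ 1 := iInf_le_of_le 0 le_rfl

lemma tendsto_Hr (d : ℕ) (ω : Om d) : Tendsto (fun r => Hr d r ω) atTop (nhds (HL d ω)) :=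
  tendsto_atTop_iInf (antitone_nat_of_succ_le (fun r => Hr_anti d r ω))

lemma HL_eq (d : ℕ) (ω : Om d) :
    HL d ω = (1 + ∑ i ∈ Finset.range (ω []),
      (∑ j : Fin d, HL d (fun l => ω ((i, j) :: l)))⁻¹)⁻¹ := by
  have h1 := (tendsto_Hr d ω).comp (tendsto_add_atTop_nat 1)
  refine tendsto_nhds_unique h1 ?_
  show Tendsto (fun r => Hr d (r + 1) ω) atTop _
  simp only [Hr]
  apply Tendsto.inv
  apply Tendsto.const_add
  apply tendsto_finsetSum
  intro i _
  apply Tendsto.inv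
  apply tendsto_finsetSum
  intro j _
  exact tendsto_Hr d _

/-- law of the fixed point -/
def muL (d : ℕ) (c : ℝ≥0) : Measure ℝ≥0∞ := (PP d c).map (HL d)

instance (d : ℕ) (c : ℝ≥0) : IsProbabilityMeasure (muL d c) :=
  Measure.isProbabilityMeasure_map (measurable_HL d).aemeasurable

def nuL (d : ℕ) (c : ℝ≥0) : Measure ℝ≥0∞ :=
  (Measure.pi (fun _ : Fin d => muL d c)).map (fun x => ∑ j, x j)

instance (d : ℕ) (c : ℝ≥0) : IsProbabilityMeasure (nuL d c) :=
  Measure.isProbabilityMeasure_map (by fun_prop)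

lemma QQ_map (d : ℕ) (c : ℝ≥0) (m : ℕ) :
    (QQ d c).map (fun g (i : Fin m) => ∑ j : Fin d, HL d (g ((i : ℕ), j))) =
      Measure.pi (fun _ : Fin m => nuL d c) := by
  have hH := measurable_HL d
  have h1 := Measure.infinitePi_map_curry (fun (_ : ℕ) (_ : Fin d) => PP d c)
  have h2 := Measure.infinitePi_map_pi (μ := fun _ : ℕ => Measure.infinitePi (fun _ : Fin d => PP d c))
    (f := fun _ (x : Fin d → Om d) => ∑ j, HL d (x j)) (fun i => by fun_prop)
  have hprob : IsProbabilityMeasure ((PP d c).map (HL d)) :=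
    Measure.isProbabilityMeasure_map hH.aemeasurable
  have h3 : (Measure.infinitePi (fun _ : Fin d => PP d c)).map (fun x => ∑ j, HL d (x j)) =
      nuL d c := by
    unfold nuL muL
    rw [← Measure.infinitePi_eq_pi, ← Measure.infinitePi_map_pi _ (fun _ => hH),
      Measure.map_map (by fun_prop) (by fun_prop)]
    rfl
  rw [h3] at h2
  have h4 := Measure.map_infinitePi_infinitePi_of_inj (P := fun _ : ℕ => nuL d c)
    (f := fun i : Fin m => (i : ℕ)) Fin.val_injective
  have h5 := h4.trans (Measure.infinitePi_eq_pi _)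
  rw [← h2, ← h1, Measure.map_map (by fun_prop) (by fun_prop),
    Measure.map_map (by fun_prop) (by fun_prop)] at h5
  exact h5

/-- The fixed point equation for the law. -/
lemma fixed_point (d : ℕ) (c : ℝ≥0) (f : ℝ≥0∞ → ℝ≥0∞) (hf : Measurable f) :
    ∫⁻ x, f x ∂(muL d c) = ∑' m, pw c m *
      ∫⁻ y, f ((1 + ∑ i, (y i)⁻¹)⁻¹) ∂(Measure.pi (fun _ : Fin m => nuL d c)) := by
  have hH := measurable_HL d
  unfold muL
  rw [lintegral_map hf hH, lintegral_PP _ _ (fun ω => f (HL d ω)) (hf.comp hH)]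
  congr 1
  ext m
  rw [← QQ_map, lintegral_map (by fun_prop) (by fun_prop)]
  congr 2
  ext g
  rw [HL_eq, Finset.sum_range]
  rfl

end LP

namespace LP
open MeasureTheory ProbabilityTheory
open scoped NNReal ENNReal

lemma lintegral_pi_succAbove {m : ℕ} (ρ : Measure ℝ≥0∞) [IsProbabilityMeasure ρ] (i : Fin (m + 1))
    (F : ℝ≥0∞ → (Fin m → ℝ≥0∞) → ℝ≥0∞) (hF : Measurable (Function.uncurry F)) :
    ∫⁻ y, F (y i) (fun k => y (i.succAbove k)) ∂(Measure.pi (fun _ : Fin (m + 1) => ρ)) =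
      ∫⁻ b, ∫⁻ a, F a b ∂ρ ∂(Measure.pi (fun _ : Fin m => ρ)) := by
  have h := measurePreserving_piFinSuccAbove (fun _ : Fin (m + 1) => ρ) i
  have h1 := lintegral_prod_symm' (μ := ρ) (ν := Measure.pi (fun _ : Fin m => ρ)) _ hF
  have h2 := h.lintegral_comp hF
  exact h2.trans h1

/-- the kernel -/
def kk (x y : ℝ≥0∞) : ℝ≥0∞ := y⁻¹ * (x⁻¹ + y⁻¹)⁻¹

lemma measurable_kk : Measurable (Function.uncurry kk) := by
  unfold kk Function.uncurry; fun_prop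

lemma point_one {m : ℕ} (y : Fin m → ℝ≥0∞) :
    (if (1 + ∑ i, (y i)⁻¹)⁻¹ ≠ 0 then 1 else 0 : ℝ≥0∞) =
      (1 + ∑ i, (y i)⁻¹)⁻¹ + ∑ i, (y i)⁻¹ * (1 + ∑ i, (y i)⁻¹)⁻¹ := by
  rw [← Finset.sum_mul]
  set T := ∑ i, (y i)⁻¹
  by_cases hT : T = ∞
  · simp [hT]
  · have : (1 + T)⁻¹ ≠ 0 := by simp [hT]
    rw [if_pos this]
    have h2 : (1 + T) * (1 + T)⁻¹ = 1 := ENNReal.mul_inv_cancel (by simp) (by simp [hT])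
    rw [add_mul, one_mul] at h2
    exact h2.symm

lemma point_two {m : ℕ} (y : Fin (m + 1) → ℝ≥0∞) (i : Fin (m + 1)) :
    (y i)⁻¹ * (1 + ∑ i, (y i)⁻¹)⁻¹ =
      kk ((1 + ∑ k, (y (i.succAbove k))⁻¹)⁻¹) (y i) := by
  unfold kk
  rw [inv_inv, Fin.sum_univ_succAbove _ i]
  congr 2
  ring

lemma kk_eq (x y : ℝ≥0∞) (hx : x ≠ ∞) (hy : y ≠ ∞) :
    x / (x + y) = kk x y + (if x ≠ 0 then 1 else 0) * (if y = 0 then 1 else 0) := by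
  unfold kk
  by_cases hx0 : x = 0
  · simp [hx0]
  by_cases hy0 : y = 0
  · simp [hx0, hy0, ENNReal.div_self hx0 hx]
  · simp only [hy0, if_false, mul_zero, add_zero]
    have e : x⁻¹ + y⁻¹ = (x + y) * (x⁻¹ * y⁻¹) := by
      rw [add_mul, ← mul_assoc, ENNReal.mul_inv_cancel hx0 hx, mul_comm x⁻¹, ← mul_assoc,
        ENNReal.mul_inv_cancel hy0 hy, one_mul, one_mul, add_comm]
    rw [e, ENNReal.mul_inv (by simp [hx0]) (by left; simp [hx, hy]), ENNReal.mul_inv (by simp [hy0]) (by simp [hy]), inv_inv, inv_inv, ENNReal.div_eq_inv_mul]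
    rw [show y⁻¹ * ((x + y)⁻¹ * (x * y)) = (y * y⁻¹) * ((x + y)⁻¹ * x) by ring,
      ENNReal.mul_inv_cancel hy0 hy, one_mul]

lemma point_three {m : ℕ} (x : Fin (m + 1) → ℝ≥0∞) (hx : ∀ i, x i ≠ ∞) :
    (if ∑ i, x i ≠ 0 then 1 else 0 : ℝ≥0∞) =
      ∑ i, (kk (x i) (∑ k, x (i.succAbove k)) +
        (if x i ≠ 0 then 1 else 0) * (if ∑ k, x (i.succAbove k) = 0 then 1 else 0)) := by
  have : ∀ i, kk (x i) (∑ k, x (i.succAbove k)) +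
        (if x i ≠ 0 then 1 else 0) * (if ∑ k, x (i.succAbove k) = 0 then 1 else 0) =
        x i / ∑ i, x i := by
    intro i
    rw [← kk_eq _ _ (hx i) (by simp [ENNReal.sum_eq_top, hx]), ← Fin.sum_univ_succAbove]
  simp_rw [this, ENNReal.div_eq_inv_mul]
  rw [← Finset.mul_sum]
  by_cases h : ∑ i, x i = 0
  · simp [h]
  · rw [if_pos h, ENNReal.inv_mul_cancel h (by simp [ENNReal.sum_eq_top, hx])]

lemma pw_succ (c : ℝ≥0) (m : ℕ) : pw c (m + 1) * ((m + 1 : ℕ) : ℝ≥0∞) = c * pw c m := by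
  unfold pw
  have e1 : ((m + 1 : ℕ) : ℝ≥0∞) = ENNReal.ofReal ((m + 1 : ℕ) : ℝ)   := by
    rw [ENNReal.ofReal_natCast]
  have e2 : (c : ℝ≥0∞) = ENNReal.ofReal (c : ℝ) := by simp
  rw [e1, e2, ← ENNReal.ofReal_mul (by positivity), ← ENNReal.ofReal_mul (by positivity)]
  congr 1
  rw [Nat.factorial_succ]
  push_cast
  have : (m.factorial : ℝ) ≠ 0 := by positivity
  field_simp
  ring

lemma muL_le_one (d : ℕ) (c : ℝ≥0) : ∀ᵐ x ∂(muL d c), x ≤ 1 := by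
  unfold muL
  rw [ae_map_iff (measurable_HL d).aemeasurable measurableSet_Iic]
  exact ae_of_all _ (HL_le_one d)

def tt (d : ℕ) (c : ℝ≥0) : ℝ≥0∞ := ∫⁻ x, (if x ≠ 0 then 1 else 0) ∂(muL d c)
def nz (d : ℕ) (c : ℝ≥0) : ℝ≥0∞ := ∫⁻ x, (if x = 0 then 1 else 0) ∂(muL d c)
def kap (d : ℕ) (c : ℝ≥0) : ℝ≥0∞ := ∫⁻ x, ∫⁻ y, kk x y ∂(nuL d c) ∂(muL d c)
def EE (d : ℕ) (c : ℝ≥0) : ℝ≥0∞ := ∫⁻ x, x ∂(muL d c)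

lemma meas_ne : Measurable (fun x : ℝ≥0∞ => (if x ≠ 0 then 1 else 0 : ℝ≥0∞)) :=
  Measurable.ite (measurableSet_singleton 0).compl measurable_const measurable_const
lemma meas_eq : Measurable (fun x : ℝ≥0∞ => (if x = 0 then 1 else 0 : ℝ≥0∞)) :=
  Measurable.ite (measurableSet_singleton 0) measurable_const measurable_const

lemma tt_add_nz (ρ : Measure ℝ≥0∞) [IsProbabilityMeasure ρ] :
    ∫⁻ x, (if x ≠ 0 then 1 else 0) ∂ρ + ∫⁻ x, (if x = 0 then 1 else 0) ∂ρ = 1 := by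
  rw [← lintegral_add_left meas_ne]
  rw [← lintegral_one.trans (measure_univ (μ := ρ))]
  congr 1; ext x; by_cases h : x = 0 <;> simp [h]

lemma pi_prod (m : ℕ) (ρ : Measure ℝ≥0∞) [IsProbabilityMeasure ρ] (f : ℝ≥0∞ → ℝ≥0∞)
    (hf : Measurable f) :
    ∫⁻ y, ∏ i, f (y i) ∂(Measure.pi (fun _ : Fin m => ρ)) = (∫⁻ x, f x ∂ρ) ^ m := by
  induction m with
  | zero => simp
  | succ m ih =>
    simp_rw [Fin.prod_univ_succAbove _ 0]
    rw [lintegral_pi_succAbove ρ 0 (fun a b => f a * ∏ i, f (b i)) (by unfold Function.uncurry; fun_prop)]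
    simp_rw [lintegral_mul_const _ hf]
    rw [lintegral_const_mul _ (by fun_prop), ih, pow_succ, mul_comm]

lemma nuL_eq (d : ℕ) (c : ℝ≥0) :
    ∫⁻ x, (if x = 0 then 1 else 0) ∂(nuL d c) = nz d c ^ d := by
  unfold nuL
  rw [lintegral_map meas_eq (by fun_prop), nz, ← pi_prod _ _ _ meas_eq]
  congr 1; ext y
  rw [Finset.prod_ite_zero]
  simp [Finset.sum_eq_zero_iff]

lemma C1 (d : ℕ) (c : ℝ≥0) :
    tt d c = ∑' m, pw c m * (∫⁻ x, (if x ≠ 0 then 1 else 0) ∂(nuL d c)) ^ m := by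
  unfold tt
  rw [fixed_point d c _ meas_ne]
  congr 1; ext m
  rw [← pi_prod _ _ _ meas_ne]
  congr 2; ext y
  rw [Finset.prod_ite_zero]
  simp [ENNReal.sum_eq_top]

lemma C2 (d : ℕ) (c : ℝ≥0) : tt d c = EE d c + c * kap d c := by
  have hm : ∀ m : ℕ, Measurable fun y : Fin m → ℝ≥0∞ => (1 + ∑ i, (y i)⁻¹)⁻¹ := by
    intro m; fun_prop
  have hk := measurable_kk
  have hg : Measurable (fun x => ∫⁻ y, kk x y ∂(nuL d c)) :=
    Measurable.lintegral_prod_right' hk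
  unfold tt EE kap
  rw [fixed_point d c _ meas_ne, fixed_point d c (fun x => x) measurable_id, fixed_point d c _ hg]
  simp_rw [point_one]
  have : ∀ m, pw c m * ∫⁻ y, ((1 + ∑ i, (y i)⁻¹)⁻¹ + ∑ i, (y i)⁻¹ * (1 + ∑ i, (y i)⁻¹)⁻¹)
      ∂(Measure.pi (fun _ : Fin m => nuL d c)) =
      pw c m * ∫⁻ y, (1 + ∑ i, (y i)⁻¹)⁻¹ ∂(Measure.pi (fun _ : Fin m => nuL d c)) +
      pw c m * ∑ i, ∫⁻ y, (y i)⁻¹ * (1 + ∑ i, (y i)⁻¹)⁻¹ ∂(Measure.pi (fun _ : Fin m => nuL d c)) := by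
    intro m
    rw [lintegral_add_left (hm m), lintegral_finsetSum _ (fun i _ => by fun_prop), mul_add]
  simp_rw [this]
  rw [ENNReal.tsum_add]
  congr 1
  rw [tsum_eq_zero_add' ENNReal.summable]
  simp only [Finset.univ_eq_empty, Finset.sum_empty, mul_zero, zero_add]
  rw [← ENNReal.tsum_mul_left]
  congr 1; ext m
  simp_rw [point_two]
  have : ∀ i : Fin (m + 1), ∫⁻ y, kk ((1 + ∑ k, (y (i.succAbove k))⁻¹)⁻¹) (y i)
      ∂(Measure.pi (fun _ : Fin (m + 1) => nuL d c)) =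
      ∫⁻ b, ∫⁻ a, kk ((1 + ∑ k, (b k)⁻¹)⁻¹) a ∂(nuL d c) ∂(Measure.pi (fun _ : Fin m => nuL d c)) := by
    intro i
    refine lintegral_pi_succAbove _ i (fun a b => kk ((1 + ∑ k, (b k)⁻¹)⁻¹) a) ?_
    exact hk.comp (by fun_prop : Measurable fun p : ℝ≥0∞ × (Fin m → ℝ≥0∞) => ((1 + ∑ k, (p.2 k)⁻¹)⁻¹, p.1))
  simp_rw [this]
  rw [Finset.sum_const, Finset.card_univ, Fintype.card_fin, nsmul_eq_mul, ← mul_assoc, pw_succ,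
    mul_assoc]

lemma C3a (d : ℕ) (c : ℝ≥0) :
    ∫⁻ x, (if ∑ i, x i ≠ 0 then 1 else 0 : ℝ≥0∞) ∂(Measure.pi (fun _ : Fin (d + 1) => muL d c))
     + nz d c ^ (d + 1) = 1 := by
  have hm : Measurable (fun x : Fin (d + 1) → ℝ≥0∞ => (if ∑ i, x i ≠ 0 then 1 else 0 : ℝ≥0∞)) :=
    meas_ne.comp (by fun_prop : Measurable fun x : Fin (d + 1) → ℝ≥0∞ => ∑ i, x i)
  rw [nz, ← pi_prod _ _ _ meas_eq, ← lintegral_add_left hm]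
  rw [← lintegral_one.trans (measure_univ (μ := Measure.pi (fun _ : Fin (d + 1) => muL d c)))]
  congr 1; ext y
  rw [Finset.prod_ite_zero]
  by_cases h : ∀ i, y i = 0
  · simp [h]
  · have : ∑ i, y i ≠ 0 := by simpa [Finset.sum_eq_zero_iff] using h
    simp [h]

lemma C3b (d : ℕ) (c : ℝ≥0) :
    ∀ᵐ x ∂(Measure.pi (fun _ : Fin (d + 1) => muL d c)), ∀ i, x i ≠ ∞ := by
  rw [ae_all_iff]
  intro i
  have := (measurePreserving_eval (fun _ : Fin (d + 1) => muL d c) i).quasiMeasurePreserving.ae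
    (muL_le_one d c)
  filter_upwards [this] with x hx
  exact ne_top_of_le_ne_top ENNReal.one_ne_top hx

lemma meas_S {d : ℕ} (i : Fin (d + 1)) :
    Measurable fun x : Fin (d + 1) → ℝ≥0∞ => ∑ k, x (i.succAbove k) := by
  fun_prop

lemma C3c (d : ℕ) (c : ℝ≥0) (i : Fin (d + 1)) :
    ∫⁻ x, kk (x i) (∑ k, x (i.succAbove k))
        ∂(Measure.pi (fun _ : Fin (d + 1) => muL d c)) = kap d c := by
  have hk := measurable_kk
  have hsum : Measurable (fun b : Fin d → ℝ≥0∞ => ∑ k, b k) := by fun_prop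
  have h1 := lintegral_pi_succAbove (muL d c) i (fun a b => kk a (∑ k, b k)) (hk.comp (by fun_prop :
      Measurable fun p : ℝ≥0∞ × (Fin d → ℝ≥0∞) => (p.1, ∑ k, p.2 k)))
  refine h1.trans ?_
  have h2 : kap d c = ∫⁻ y, ∫⁻ x, kk x y ∂(muL d c) ∂(nuL d c) :=
    lintegral_lintegral_swap (hk.aemeasurable)
  have h3 : Measurable fun y => ∫⁻ x, kk x y ∂(muL d c) := Measurable.lintegral_prod_left' hk
  rw [h2, nuL, lintegral_map h3 hsum]

lemma C3d (d : ℕ) (c : ℝ≥0) (i : Fin (d + 1)) :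
    ∫⁻ x, ((if x i ≠ 0 then 1 else 0) * (if ∑ k, x (i.succAbove k) = 0 then 1 else 0) : ℝ≥0∞)
        ∂(Measure.pi (fun _ : Fin (d + 1) => muL d c)) = tt d c * nz d c ^ d := by
  have hsum : Measurable (fun b : Fin d → ℝ≥0∞ => ∑ k, b k) := by fun_prop
  have h1 := lintegral_pi_succAbove (muL d c) i (fun a b => ((if a ≠ 0 then 1 else 0) *
        (if ∑ k, b k = 0 then 1 else 0) : ℝ≥0∞)) ((meas_ne.comp measurable_fst).mul
          (meas_eq.comp (hsum.comp measurable_snd)))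
  refine h1.trans ?_
  simp_rw [lintegral_mul_const _ meas_ne]
  have hm : Measurable fun b : Fin d → ℝ≥0∞ => (if ∑ k, b k = 0 then 1 else 0 : ℝ≥0∞) :=
    meas_eq.comp hsum
  rw [lintegral_const_mul _ hm, ← nuL_eq, nuL, lintegral_map meas_eq hsum]
  rfl

lemma lint_aux {α : Type*} [MeasurableSpace α] (ρ : Measure α) (m : ℕ)
    (f g : Fin m → α → ℝ≥0∞) (hf : ∀ i, Measurable (f i)) (hg : ∀ i, Measurable (g i))
    (a b : ℝ≥0∞) (ha : ∀ i, ∫⁻ x, f i x ∂ρ = a) (hb : ∀ i, ∫⁻ x, g i x ∂ρ = b) :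
    ∫⁻ x, ∑ i, (f i x + g i x) ∂ρ = m * (a + b) := by
  rw [lintegral_finsetSum (f := fun i x => f i x + g i x) _ (fun i _ => (hf i).add (hg i))]
  have : ∀ i, ∫⁻ x, (f i x + g i x) ∂ρ = a + b := by
    intro i; rw [lintegral_add_left (hf i), ha, hb]
  simp [this, mul_add]

lemma meas_kk2 {α : Type*} [MeasurableSpace α] {f g : α → ℝ≥0∞} (hf : Measurable f)
    (hg : Measurable g) : Measurable fun x => kk (f x) (g x) :=
  measurable_kk.comp (hf.prodMk hg)

lemma meas_prod2 {α : Type*} [MeasurableSpace α] {f g : α → ℝ≥0∞} (hf : Measurable f)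
    (hg : Measurable g) :
    Measurable fun x => ((if f x ≠ 0 then 1 else 0) * (if g x = 0 then 1 else 0) : ℝ≥0∞) :=
  (meas_ne.comp hf).mul (meas_eq.comp hg)

lemma C3 (d : ℕ) (c : ℝ≥0) : 1 = nz d c ^ (d + 1) + (d + 1) * (kap d c + tt d c * nz d c ^ d) := by
  have hk := measurable_kk
  refine ((add_comm _ _).trans (Eq.trans ?_ (C3a d c))).symm
  congr 1
  have hcong : ∫⁻ x, (if ∑ i, x i ≠ 0 then 1 else 0 : ℝ≥0∞)
      ∂(Measure.pi (fun _ : Fin (d + 1) => muL d c)) =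
      ∫⁻ x, ∑ i, (kk (x i) (∑ k, x (i.succAbove k)) +
        (if x i ≠ 0 then 1 else 0) * (if ∑ k, x (i.succAbove k) = 0 then 1 else 0))
      ∂(Measure.pi (fun _ : Fin (d + 1) => muL d c)) := by
    apply lintegral_congr_ae
    filter_upwards [C3b d c] with x hx using point_three x hx
  refine Eq.trans ?_ hcong.symm
  have := lint_aux (Measure.pi (fun _ : Fin (d + 1) => muL d c)) (d + 1)
    (fun i x => kk (x i) (∑ k, x (i.succAbove k)))
    (fun i x => (if x i ≠ 0 then 1 else 0) * (if ∑ k, x (i.succAbove k) = 0 then 1 else 0))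
    (fun i => meas_kk2 (measurable_pi_apply i) (meas_S i))
    (fun i => meas_prod2 (measurable_pi_apply i) (meas_S i))
    (kap d c) (tt d c * nz d c ^ d) (C3c d c) (C3d d c)
  refine Eq.trans ?_ this.symm
  push_cast
  rfl

/-- Summary of part C. -/
theorem limit_law (d : ℕ) (c : ℝ≥0) :
    ∃ t : ℝ, 0 < t ∧ t ≤ 1 ∧ t = Real.exp (-c * (1 - t) ^ d) ∧
      (EE d c).toReal = t - c / (d + 1) * (1 - (1 - t) ^ (d + 1)) + c * t * (1 - t) ^ d := by
  have h1 : tt d c + nz d c = 1 := tt_add_nz (muL d c)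
  have h2 := tt_add_nz (nuL d c)
  rw [nuL_eq] at h2
  have h3 := C1 d c
  set u := ∫⁻ x, (if x ≠ 0 then 1 else 0) ∂(nuL d c) with hu
  have htt : tt d c ≠ ∞ := ne_top_of_le_ne_top ENNReal.one_ne_top (h1 ▸ le_self_add)
  have hnz : nz d c ≠ ∞ := ne_top_of_le_ne_top ENNReal.one_ne_top (h1 ▸ le_add_self)
  have hut : u ≠ ∞ := ne_top_of_le_ne_top ENNReal.one_ne_top (h2 ▸ le_self_add)
  have h1r : (tt d c).toReal + (nz d c).toReal = 1 := by
    rw [← ENNReal.toReal_add htt hnz, h1]; simp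
  have h2r : u.toReal + (nz d c).toReal ^ d = 1 := by
    rw [← ENNReal.toReal_pow, ← ENNReal.toReal_add hut (by simp [hnz]), h2]; simp
  have h4 := C2 d c
  have h5 := C3 d c
  have hk : kap d c ≠ ∞ := by
    intro h
    rw [h] at h5
    simp at h5
  have hE : EE d c ≠ ∞ := by
    intro h; rw [h] at h4; simp [htt] at h4
  have h4r : (tt d c).toReal = (EE d c).toReal + c * (kap d c).toReal := by
    rw [h4, ENNReal.toReal_add hE (by finiteness), ENNReal.toReal_mul]; simp
  have h5r : 1 = (nz d c).toReal ^ (d + 1) +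
      (d + 1) * ((kap d c).toReal + (tt d c).toReal * (nz d c).toReal ^ d) := by
    have := congrArg ENNReal.toReal h5
    rw [ENNReal.toReal_add (by finiteness) (by finiteness), ENNReal.toReal_mul,
      ENNReal.toReal_add (a := kap d c) (by finiteness) (by finiteness), ENNReal.toReal_mul,
      ENNReal.toReal_pow, ENNReal.toReal_pow, ENNReal.toReal_add (by finiteness) (by finiteness)] at this
    simpa using this
  have h3r : (tt d c).toReal = Real.exp (-c * (1 - (tt d c).toReal) ^ d) := by
    have e1 : 1 - (tt d c).toReal = (nz d c).toReal := by linarith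
    rw [e1, show -(c : ℝ) * (nz d c).toReal ^ d = -c + c * u.toReal by
      rw [← sub_eq_iff_eq_add'.mpr h2r.symm]; ring, Real.exp_add, h3]
    have hs : HasSum (fun m : ℕ => Real.exp (-c) * ((c * u.toReal) ^ m / m.factorial))
        (Real.exp (-c) * Real.exp (c * u.toReal)) := by
      apply HasSum.mul_left
      rw [Real.exp_eq_exp_ℝ]
      exact NormedSpace.expSeries_div_hasSum_exp _
    rw [← hs.tsum_eq, ENNReal.tsum_toReal_eq]
    · congr 1; ext m
      rw [ENNReal.toReal_mul, pw, ENNReal.toReal_ofReal (by positivity), ENNReal.toReal_pow, mul_pow]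
      ring
    · intro m; unfold pw; finiteness
  have ht0 : 0 < (tt d c).toReal := h3r ▸ Real.exp_pos _
  have hn0 : 0 ≤ (nz d c).toReal := ENNReal.toReal_nonneg
  refine ⟨_, ht0, by linarith, h3r, ?_⟩
  have e1 : (nz d c).toReal = 1 - (tt d c).toReal := by linarith
  rw [e1] at h5r
  have hd : (d : ℝ) + 1 ≠ 0 := by positivity
  have hkk : (kap d c).toReal = (1 - (1 - (tt d c).toReal) ^ (d + 1)) / (d + 1) -
    (tt d c).toReal * (1 - (tt d c).toReal) ^ d := by
    field_simp
    linarith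
  rw [hkk] at h4r
  field_simp at h4r ⊢
  linarith

end LP

namespace LP
open MeasureTheory ProbabilityTheory
open scoped NNReal ENNReal

/-- shapes of depth `r` trees -/
@[reducible] def Shape (d : ℕ) : ℕ → Type
  | 0 => Unit
  | r + 1 => Σ m : ℕ, (Fin m × Fin d → Shape d r)

def hS (d : ℕ) : (r : ℕ) → Shape d r → ℝ
  | 0, _ => 1
  | r + 1, s => (1 + ∑ i : Fin s.1, (∑ j : Fin d, hS d r (s.2 (i, j)))⁻¹)⁻¹

lemma hS_pos (d r : ℕ) (s : Shape d r) : 0 < hS d r s := by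
  induction r with
  | zero => exact one_pos
  | succ r ih =>
    unfold hS
    have : 0 ≤ ∑ i : Fin s.1, (∑ j : Fin d, hS d r (s.2 (i, j)))⁻¹ :=
      Finset.sum_nonneg fun i _ => inv_nonneg.mpr (Finset.sum_nonneg fun j _ => (ih _).le)
    positivity

lemma hS_le_one (d r : ℕ) (s : Shape d r) : hS d r s ≤ 1 := by
  cases r with
  | zero => exact le_rfl
  | succ r =>
    unfold hS
    have : 0 ≤ ∑ i : Fin s.1, (∑ j : Fin d, hS d r (s.2 (i, j)))⁻¹ :=
      Finset.sum_nonneg fun i _ => inv_nonneg.mpr (Finset.sum_nonneg fun j _ => (hS_pos _ _ _).le)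
    apply inv_le_one_of_one_le₀
    linarith

def wS (d : ℕ) (c : ℝ) : (r : ℕ) → Shape d r → ℝ
  | 0, _ => 1
  | r + 1, s => (Real.exp (-c) * c ^ s.1 / s.1.factorial) * ∏ q, wS d c r (s.2 q)

lemma wS_nonneg (d : ℕ) (c : ℝ) (hc : 0 ≤ c) (r : ℕ) (s : Shape d r) : 0 ≤ wS d c r s := by
  induction r with
  | zero => exact zero_le_one
  | succ r ih =>
    unfold wS
    have := Finset.prod_nonneg fun q (_ : q ∈ Finset.univ) => ih (s.2 q)
    positivity

def Box (d M : ℕ) : (r : ℕ) → Finset (Shape d r)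
  | 0 => {()}
  | r + 1 => (Finset.range (M + 1)).sigma fun _ => Fintype.piFinset fun _ => Box d M r

def TT (d : ℕ) : (r : ℕ) → Om d → Shape d r
  | 0, _ => ()
  | r + 1, ω => ⟨ω [], fun q => TT d r (fun l => ω (((q.1 : ℕ), q.2) :: l))⟩

lemma hS_TT (d : ℕ) (hd : 1 ≤ d) (r : ℕ) (ω : Om d) :
    ENNReal.ofReal (hS d r (TT d r ω)) = Hr d r ω := by
  induction r generalizing ω with
  | zero => simp [hS, Hr]
  | succ r ih =>
    have hne : Nonempty (Fin d) := ⟨⟨0, hd⟩⟩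
    have hp : ∀ i, 0 < ∑ j : Fin d, hS d r (TT d r (fun l => ω ((i, j) :: l))) := fun i =>
      Finset.sum_pos (fun j _ => hS_pos _ _ _) Finset.univ_nonempty
    have hq : ∀ i, 0 ≤ (∑ j : Fin d, hS d r (TT d r (fun l => ω ((i, j) :: l))))⁻¹ := fun i =>
      inv_nonneg.mpr (hp i).le
    show ENNReal.ofReal ((1 + ∑ i : Fin (ω []), (∑ j : Fin d,
      hS d r (TT d r (fun l => ω (((i : ℕ), j) :: l))))⁻¹)⁻¹) = _
    show _ = (1 + ∑ i ∈ Finset.range (ω []),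
      (∑ j : Fin d, Hr d r (fun l => ω ((i, j) :: l)))⁻¹)⁻¹
    rw [Finset.sum_range, ENNReal.ofReal_inv_of_pos (by
      have := Finset.sum_nonneg fun i (_ : i ∈ (Finset.univ : Finset (Fin (ω [])))) => hq i
      linarith), ENNReal.ofReal_add zero_le_one (Finset.sum_nonneg fun (i : Fin (ω [])) _ => hq i),
      ENNReal.ofReal_sum_of_nonneg fun (i : Fin (ω [])) _ => hq i]
    simp only [ENNReal.ofReal_one]
    congr 2
    refine Finset.sum_congr rfl fun i _ => ?_
    rw [ENNReal.ofReal_inv_of_pos (hp i), ENNReal.ofReal_sum_of_nonneg fun j _ => (hS_pos _ _ _).le]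
    simp_rw [ih]

lemma TT_eq_iff (d r : ℕ) (ω : Om d) (s : Shape d (r + 1)) :
    TT d (r + 1) ω = s ↔ ω [] = s.1 ∧ ∀ q : Fin s.1 × Fin d,
      TT d r (fun l => ω (((q.1 : ℕ), q.2) :: l)) = s.2 q := by
  obtain ⟨m, f⟩ := s
  show (⟨ω [], _⟩ : Σ m : ℕ, (Fin m × Fin d → Shape d r)) = ⟨m, f⟩ ↔ _
  constructor
  · intro h
    generalize hm : ω [] = m' at h
    cases h
    exact ⟨rfl, fun q => rfl⟩
  · rintro ⟨h1, h2⟩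
    simp only at h1 h2
    subst h1
    congr 1
    funext q; exact h2 q

lemma measurableSet_TT (d r : ℕ) (s : Shape d r) : MeasurableSet {ω | TT d r ω = s} := by
  induction r with
  | zero =>
    convert MeasurableSet.univ using 1
    ext ω; simp
  | succ r ih =>
    have hset : {ω | TT d (r + 1) ω = s} = {ω | ω [] = s.1} ∩ ⋂ q : Fin s.1 × Fin d,
        {ω | TT d r (fun l => ω (((q.1 : ℕ), q.2) :: l)) = s.2 q} := by
      ext ω
      refine (TT_eq_iff d r ω s).trans ?_
      simp only [Set.mem_inter_iff, Set.mem_iInter, Set.mem_ofPred_eq]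
    rw [hset]
    refine MeasurableSet.inter ?_ (MeasurableSet.iInter fun q => ?_)
    · have h0 : Measurable fun ω : Om d => ω [] := measurable_pi_apply _
      exact h0 (measurableSet_singleton s.1)
    · exact (by fun_prop : Measurable fun (ω : Om d) l => ω (((q.1 : ℕ), q.2) :: l)) (ih (s.2 q))

lemma PP_TT (d : ℕ) (c : ℝ≥0) (r : ℕ) (s : Shape d r) :
    PP d c {ω | TT d r ω = s} = ENNReal.ofReal (wS d c r s) := by
  induction r with
  | zero =>
    have : {ω : Om d | TT d 0 ω = s} = Set.univ := by
      ext ω; simp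
    rw [this]; simp [wS]
  | succ r ih =>
    have hinj : Function.Injective (fun q : Fin s.1 × Fin d => ((q.1 : ℕ), q.2)) := by
      rintro ⟨a, b⟩ ⟨a', b'⟩ h; simpa [Fin.ext_iff] using h
    have hlaw := (Measure.map_infinitePi_infinitePi_of_inj (P := fun _ : ℕ × Fin d => PP d c)
      hinj).trans (Measure.infinitePi_eq_pi _)
    rw [← lintegral_indicator_one (measurableSet_TT d (r + 1) s),
      lintegral_PP _ _ _ (measurable_one.indicator (measurableSet_TT d (r + 1) s)),
      tsum_eq_single s.1]
    · have hms : MeasurableSet (Set.pi Set.univ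
        (fun q : Fin s.1 × Fin d => {ω | TT d r ω = s.2 q})) :=
        MeasurableSet.univ_pi fun q => measurableSet_TT _ _ _
      have e : ∀ g : ℕ × Fin d → Om d, ({ω | TT d (r + 1) ω = s} : Set (Om d)).indicator
          (1 : Om d → ℝ≥0∞) (glue d (s.1, g)) =
          (Set.pi Set.univ (fun q : Fin s.1 × Fin d => {ω | TT d r ω = s.2 q})).indicator
          1 (fun q : Fin s.1 × Fin d => g ((q.1 : ℕ), q.2)) := by
        intro g
        have hh := TT_eq_iff d r (glue d (s.1, g)) s
        simp only [glue, true_and] at hh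
        simp only [Set.indicator, Set.mem_ofPred_eq, Set.mem_pi, Set.mem_univ, true_implies]
        by_cases h : TT d (r + 1) (glue d (s.1, g)) = s
        · rw [if_pos h, if_pos (hh.mp h)]; rfl
        · rw [if_neg h, if_neg (fun h' => h (hh.mpr h'))]
      simp_rw [e]
      rw [← lintegral_map (measurable_one.indicator hms) (by fun_prop)]
      have : (QQ d c).map (fun g (q : Fin s.1 × Fin d) => g ((q.1 : ℕ), q.2)) =
        Measure.pi fun _ => PP d c := hlaw
      rw [this, lintegral_indicator_one hms, Measure.pi_pi]
      simp_rw [ih]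
      rw [← ENNReal.ofReal_prod_of_nonneg fun q _ => wS_nonneg d c c.2 r (s.2 q), pw,
        ← ENNReal.ofReal_mul (by positivity)]
      rfl
    · intro m hm
      have e : ∀ g : ℕ × Fin d → Om d, ({ω | TT d (r + 1) ω = s} : Set (Om d)).indicator
          (1 : Om d → ℝ≥0∞) (glue d (m, g)) = 0 := by
        intro g
        apply Set.indicator_of_notMem
        intro h
        exact hm ((TT_eq_iff d r (glue d (m, g)) s).mp h).1
      simp_rw [e]; simp

lemma Box_mono (d r : ℕ) : Monotone (fun M => Box d M r) := by
  intro M N h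
  induction r with
  | zero => exact le_rfl
  | succ r ih =>
    show (Finset.range (M + 1)).sigma (fun _ => Fintype.piFinset fun _ => Box d M r) ≤
      (Finset.range (N + 1)).sigma (fun _ => Fintype.piFinset fun _ => Box d N r)
    apply Finset.sigma_mono
    · intro x; simp; omega
    · intro i
      exact Fintype.piFinset_subset _ _ fun _ => ih

lemma Box_exh (d r : ℕ) (s : Shape d r) : ∃ M, s ∈ Box d M r := by
  induction r with
  | zero => exact ⟨0, Finset.mem_singleton.mpr rfl⟩
  | succ r ih =>
    choose N hN using fun q => ih (s.2 q)
    refine ⟨max s.1 (Finset.univ.sup N), ?_⟩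
    show _ ∈ (Finset.range (_ + 1)).sigma (fun _ => Fintype.piFinset fun _ => Box d _ r)
    rw [Finset.mem_sigma]
    refine ⟨by simp, Fintype.mem_piFinset.mpr fun q => ?_⟩
    exact Box_mono d r ((Finset.le_sup (Finset.mem_univ q)).trans (le_max_right _ _)) (hN q)

theorem box_approx (d : ℕ) (hd : 1 ≤ d) (c : ℝ≥0) (a : ℝ) (ha : a < 1 - (EE d c).toReal) :
    ∃ r M, a < ∑ s ∈ Box d M r, wS d c r s * (1 - hS d r s) := by
  have hE : EE d c ≤ 1 := by
    unfold EE
    calc ∫⁻ x, x ∂(muL d c) ≤ ∫⁻ x, 1 ∂(muL d c) := lintegral_mono_ae (muL_le_one d c)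
      _ = 1 := by simp
  have hEt : EE d c ≠ ∞ := ne_top_of_le_ne_top ENNReal.one_ne_top hE
  by_cases ha0 : a < 0
  · refine ⟨0, 0, lt_of_lt_of_le ha0 (Finset.sum_nonneg fun s _ => mul_nonneg
      (wS_nonneg _ _ c.2 _ _) (by linarith [hS_le_one d 0 s]))⟩
  push Not at ha0
  have h1 : ENNReal.ofReal a < 1 - EE d c := by
    rw [ENNReal.ofReal_lt_iff_lt_toReal ha0 (by finiteness), ENNReal.toReal_sub_of_le hE (by simp)]
    simpa using ha
  have h2 : 1 - EE d c = ⨆ r, ∫⁻ ω, (1 - Hr d r ω) ∂(PP d c) := by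
    rw [← lintegral_iSup (f := fun r ω => 1 - Hr d r ω)
      (fun r => measurable_const.sub (measurable_Hr d r))]
    · have : ∀ ω, ⨆ r, (1 - Hr d r ω) = 1 - HL d ω := by
        intro ω; rw [HL, ENNReal.sub_iInf]
      simp_rw [this]
      rw [lintegral_sub (measurable_HL d) _ (ae_of_all _ (HL_le_one d))]
      · simp [EE, muL, lintegral_map measurable_id' (measurable_HL d)]
      · have : ∫⁻ ω, HL d ω ∂(PP d c) = EE d c := by
          simp [EE, muL, lintegral_map measurable_id' (measurable_HL d)]
        rw [this]; exact hEt
    · intro r r' h ω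
      exact tsub_le_tsub_left (antitone_nat_of_succ_le (f := fun r => Hr d r ω) (fun r => Hr_anti d r ω) h) _
  rw [h2, lt_iSup_iff] at h1
  obtain ⟨r, hr⟩ := h1
  let φ : ℕ → Om d → ℝ≥0∞ := fun M ω => ∑ s ∈ Box d M r,
    ({ω | TT d r ω = s} : Set (Om d)).indicator (fun _ => ENNReal.ofReal (1 - hS d r s)) ω
  have hφ : ∀ M ω, φ M ω = if TT d r ω ∈ Box d M r then 1 - Hr d r ω else 0 := by
    intro M ω
    simp only [φ, Set.indicator, Set.mem_ofPred_eq]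
    rw [Finset.sum_ite_eq]
    congr 1
    rw [ENNReal.ofReal_sub _ (hS_pos _ _ _).le, hS_TT d hd]; simp
  have hφm : ∀ M, Measurable (φ M) := fun M => Finset.measurable_fun_sum _ fun s _ =>
    measurable_const.indicator (measurableSet_TT d r s)
  have h3 : ∫⁻ ω, (1 - Hr d r ω) ∂(PP d c) = ⨆ M, ∫⁻ ω, φ M ω ∂(PP d c) := by
    rw [← lintegral_iSup hφm]
    · congr 1; ext ω
      apply le_antisymm
      · obtain ⟨M, hM⟩ := Box_exh d r (TT d r ω)
        refine le_iSup_of_le M ?_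
        rw [hφ, if_pos hM]
      · apply iSup_le
        intro M; rw [hφ]; split_ifs <;> simp
    · intro M N h ω
      rw [hφ, hφ]
      split_ifs with h1 h2
      · exact le_rfl
      · exact absurd (Box_mono d r h h1) h2
      · exact zero_le
      · exact le_rfl
  rw [h3, lt_iSup_iff] at hr
  obtain ⟨M, hM⟩ := hr
  refine ⟨r, M, ?_⟩
  have h4 : ∫⁻ ω, φ M ω ∂(PP d c) =
      ENNReal.ofReal (∑ s ∈ Box d M r, wS d c r s * (1 - hS d r s)) := by
    simp only [φ]
    rw [lintegral_finsetSum _ fun s _ => measurable_const.indicator (measurableSet_TT d r s),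
      ENNReal.ofReal_sum_of_nonneg fun s _ => mul_nonneg (wS_nonneg d c c.2 r s)
        (by linarith [hS_le_one d r s])]
    refine Finset.sum_congr rfl fun s _ => ?_
    rw [lintegral_indicator_const (measurableSet_TT d r s), PP_TT,
      ENNReal.ofReal_mul (wS_nonneg d c c.2 r s), mul_comm]
  rw [h4] at hM
  exact (ENNReal.ofReal_lt_ofReal_iff_of_nonneg ha0).mp hM

end LP

namespace LP

lemma exists_dist {ι : Type*} [Fintype ι] [DecidableEq ι] (W : Submodule ℝ (ι → ℝ)) :
    ∃ h : ι → ℝ, (∀ i, h i ≤ 1) ∧ (Module.finrank ℝ W : ℝ) = ∑ i, (1 - h i) ∧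
      ∀ i, ∀ w ∈ W, h i ≤ ∑ j, ((if j = i then 1 else 0) - w j) ^ 2 := by
  let e := (WithLp.linearEquiv 2 ℝ (ι → ℝ)).symm
  let W' : Submodule ℝ (EuclideanSpace ℝ ι) := W.map e.toLinearMap
  have hfin : Module.finrank ℝ W' = Module.finrank ℝ W := LinearEquiv.finrank_map_eq e W
  let b := EuclideanSpace.basisFun ι ℝ
  have hone : ∀ i, ‖b i‖ = 1 := fun i => b.orthonormal.1 i
  have hpy : ∀ i, ‖b i‖ ^ 2 = ‖W'.starProjection (b i)‖ ^ 2 + ‖b i - W'.starProjection (b i)‖ ^ 2 := by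
    intro i
    have := Submodule.norm_sq_eq_add_norm_sq_starProjection (𝕜 := ℝ) (b i) W'
    rwa [Submodule.starProjection_orthogonal_val] at this
  have hproj : LinearMap.IsProj W' (W'.starProjection : EuclideanSpace ℝ ι →ₗ[ℝ] EuclideanSpace ℝ ι) :=
    ⟨fun x => Submodule.starProjection_apply_mem _ x,
      fun x hx => Submodule.starProjection_eq_self_iff.mpr hx⟩
  have htr := hproj.trace
  rw [LinearMap.trace_eq_sum_inner _ b, hfin] at htr
  have hin : ∀ i, inner ℝ (b i) (W'.starProjection (b i)) = ‖W'.starProjection (b i)‖ ^ 2 := by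
    intro i
    rw [← real_inner_self_eq_norm_sq, Submodule.inner_starProjection_left_eq_right,
      Submodule.starProjection_eq_self_iff.mpr (Submodule.starProjection_apply_mem _ _)]
  refine ⟨fun i => ‖b i - W'.starProjection (b i)‖ ^ 2, ?_, ?_, ?_⟩
  · intro i
    have := hpy i
    rw [hone] at this
    simp only
    nlinarith [sq_nonneg ‖W'.starProjection (b i)‖]
  · rw [← htr]
    refine Finset.sum_congr rfl fun i _ => ?_
    have := hpy i
    rw [hone] at this
    have h2 := hin i
    simp only [ContinuousLinearMap.coe_coe]
    rw [h2]; linarith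
  · intro i w hw
    have hw' : e w ∈ W' := Submodule.mem_map_of_mem hw
    have h1 : ‖b i - W'.starProjection (b i)‖ ≤ ‖b i - e w‖ := by
      rw [Submodule.starProjection_minimal]
      exact ciInf_le (f := fun x : W' => ‖b i - x‖) ⟨0, by rintro _ ⟨x, rfl⟩; positivity⟩ ⟨e w, hw'⟩
    have h2 : ‖b i - e w‖ ^ 2 = ∑ j, ((if j = i then 1 else 0) - w j) ^ 2 := by
      rw [EuclideanSpace.norm_sq_eq]
      refine Finset.sum_congr rfl fun j _ => ?_
      simp [b, e, Pi.single_apply]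
    rw [← h2]
    exact pow_le_pow_left₀ (norm_nonneg _) h1 2

/-- squared distance of `e_ρ` to the image of the boundary map -/
def hF {n : ℕ} (F : Finset (Finset (Fin n))) : Finset (Fin n) → ℝ :=
  (exists_dist (LinearMap.range (boundaryMap n F))).choose

lemma hF_le_one {n : ℕ} (F : Finset (Finset (Fin n))) (ρ) : hF F ρ ≤ 1 :=
  (exists_dist (LinearMap.range (boundaryMap n F))).choose_spec.1 ρ

lemma hF_le {n : ℕ} (F : Finset (Finset (Fin n))) (ρ) (w) (hw : w ∈ LinearMap.range (boundaryMap n F)) :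
    hF F ρ ≤ ∑ j, ((if j = ρ then 1 else 0) - w j) ^ 2 :=
  (exists_dist (LinearMap.range (boundaryMap n F))).choose_spec.2.2 ρ w hw

lemma dimKer_le {n : ℕ} (d : ℕ) (F : Finset (Finset (Fin n))) :
    (dimKer n F : ℝ) ≤ F.card - ∑ τ ∈ Finset.powersetCard d Finset.univ, (1 - hF F τ) := by
  have h1 := (exists_dist (LinearMap.range (boundaryMap n F))).choose_spec.2.1
  have h2 := LinearMap.finrank_range_add_finrank_ker (boundaryMap n F)
  rw [Module.finrank_fintype_fun_eq_card, Fintype.card_coe] at h2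
  have h3 : (Module.finrank ℝ (LinearMap.range (boundaryMap n F)) : ℝ) + dimKer n F = F.card := by
    exact_mod_cast h2
  have h4 : ∑ τ ∈ Finset.powersetCard d Finset.univ, (1 - hF F τ) ≤ ∑ τ, (1 - hF F τ) :=
    Finset.sum_le_sum_of_subset_of_nonneg (Finset.subset_univ _)
      fun i _ _ => by linarith [hF_le_one F i]
  have h5 : (Module.finrank ℝ (LinearMap.range (boundaryMap n F)) : ℝ) = ∑ τ, (1 - hF F τ) := h1
  linarith

end LP

namespace LP

/-- nodes of a shape -/
@[reducible] def Nodes (d : ℕ) : (r : ℕ) → Shape d r → Type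
  | 0, _ => Empty
  | r + 1, s => Fin s.1 ⊕ (Σ q : Fin s.1 × Fin d, Nodes d r (s.2 q))

/-- image of a tuple -/
def img {n d : ℕ} (x : Fin d → Fin n) : Finset (Fin n) := Finset.univ.image x

/-- faces required to be present -/
def AA {n d : ℕ} : (r : ℕ) → (s : Shape d r) → (Nodes d r s → Fin n) → (Fin d → Fin n) →
    Finset (Finset (Fin n))
  | 0, _, _, _ => ∅
  | r + 1, s, l, x => (Finset.univ.image fun i : Fin s.1 => insert (l (Sum.inl i)) (img x)) ∪
      Finset.univ.biUnion fun q : Fin s.1 × Fin d => AA r (s.2 q) (fun a => l (Sum.inr ⟨q, a⟩))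
        (Function.update x q.2 (l (Sum.inl q.1)))

/-- basis vectors -/
def ee {n : ℕ} (ρ : Finset (Fin n)) : Finset (Fin n) → ℝ := fun ρ' => if ρ' = ρ then 1 else 0

def sgn {n : ℕ} (σ : Finset (Fin n)) (v : Fin n) : ℝ := (-1 : ℝ) ^ (σ.filter (fun w => w < v)).card

lemma sgn_sq {n : ℕ} (σ : Finset (Fin n)) (v : Fin n) : sgn σ v * sgn σ v = 1 := by
  unfold sgn; rw [← mul_pow]; simp

lemma bdCoeff_eq {n : ℕ} (ρ σ : Finset (Fin n)) :
    bdCoeff ρ σ = ∑ v ∈ σ, sgn σ v * ee (σ.erase v) ρ := by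
  unfold bdCoeff ee
  split_ifs with h
  · obtain ⟨h1, h2⟩ := h
    have hc : (σ \ ρ).card = 1 := by rw [Finset.card_sdiff_of_subset h1]; omega
    obtain ⟨w, hw⟩ := Finset.card_eq_one.mp hc
    have hwm : w ∈ σ \ ρ := by rw [hw]; simp
    rw [Finset.mem_sdiff] at hwm
    have hρ : ρ = σ.erase w := by
      rw [← Finset.sdiff_singleton_eq_erase, ← hw, Finset.sdiff_sdiff_eq_self h1]
    rw [hw, Finset.sum_singleton, Finset.sum_eq_single w]
    · rw [if_pos hρ, mul_one]; rfl
    · intro b hb hbw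
      rw [if_neg, mul_zero]
      intro hb2
      apply hwm.2
      rw [hb2]
      exact Finset.mem_erase.mpr ⟨fun h => hbw h.symm, hwm.1⟩
    · intro h; exact absurd hwm.1 h
  · symm
    apply Finset.sum_eq_zero
    intro v hv
    rw [if_neg, mul_zero]
    rintro rfl
    exact h ⟨Finset.erase_subset _ _, Finset.card_erase_add_one hv⟩

lemma boundary_mem {n : ℕ} (F : Finset (Finset (Fin n))) (σ : Finset (Fin n)) (hσ : σ ∈ F) :
    (∑ v ∈ σ, sgn σ v • ee (σ.erase v)) ∈ LinearMap.range (boundaryMap n F) := by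
  refine ⟨Pi.single ⟨σ, hσ⟩ 1, ?_⟩
  funext ρ
  show ∑ σ' ∈ F.attach, (Pi.single (⟨σ, hσ⟩ : F) (1 : ℝ) : F → ℝ) σ' * bdCoeff ρ σ'.1 = _
  rw [Finset.sum_eq_single ⟨σ, hσ⟩]
  · rw [Pi.single_eq_same, one_mul, bdCoeff_eq]
    simp
  · intro b _ hb
    rw [Pi.single_eq_of_ne hb, zero_mul]
  · simp

lemma img_update {n d : ℕ} (x : Fin d → Fin n) (hx : Function.Injective x) (v : Fin n)
    (hv : ∀ j, x j ≠ v) (j : Fin d) :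
    img (Function.update x j v) = (insert v (img x)).erase (x j) := by
  ext w
  simp only [img, Finset.mem_image, Finset.mem_univ, true_and, Finset.mem_erase,
    Finset.mem_insert]
  constructor
  · rintro ⟨k, rfl⟩
    by_cases hk : k = j
    · subst hk
      simp only [Function.update_self]
      exact ⟨fun h => hv k h.symm, Or.inl trivial⟩
    · rw [Function.update_of_ne hk]
      exact ⟨fun h => hk (hx h), Or.inr ⟨k, rfl⟩⟩
  · rintro ⟨h1, rfl | ⟨k, rfl⟩⟩
    · exact ⟨j, by simp⟩
    · exact ⟨k, by rw [Function.update_of_ne]; rintro rfl; exact h1 rfl⟩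

lemma update_inj {n d : ℕ} (x : Fin d → Fin n) (hx : Function.Injective x) (v : Fin n)
    (hv : ∀ j, x j ≠ v) (j : Fin d) : Function.Injective (Function.update x j v) := by
  intro a b h
  by_cases ha : a = j <;> by_cases hb : b = j
  · rw [ha, hb]
  · subst ha; rw [Function.update_self, Function.update_of_ne hb] at h
    exact absurd h.symm (hv b)
  · subst hb; rw [Function.update_self, Function.update_of_ne ha] at h
    exact absurd h (hv a)
  · rw [Function.update_of_ne ha, Function.update_of_ne hb] at h; exact hx h

lemma mem_img {n d : ℕ} (x : Fin d → Fin n) (w : Fin n) : w ∈ img x ↔ ∃ j, x j = w := by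
  simp [img]

lemma face_rel {n d : ℕ} (F : Finset (Finset (Fin n))) (x : Fin d → Fin n)
    (hx : Function.Injective x) (v : Fin n)
    (hv : ∀ j, x j ≠ v) (hF : insert v (img x) ∈ F) :
    ∃ η : Fin d → ℝ, (∀ j, η j ^ 2 = 1) ∧
      (ee (img x) + ∑ j, η j • ee (img (Function.update x j v))) ∈
        LinearMap.range (boundaryMap n F) := by
  have h1 := boundary_mem F _ hF
  have hvn : v ∉ img x := by rw [mem_img]; rintro ⟨j, h⟩; exact hv j h
  set σ := insert v (img x) with hσ
  refine ⟨fun j => sgn σ v * sgn σ (x j), fun j => ?_, ?_⟩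
  · have := sgn_sq σ v
    have := sgn_sq σ (x j)
    simp only [sgn] at *
    nlinarith
  have h2 := Submodule.smul_mem _ (sgn σ v) h1
  convert h2 using 1
  rw [hσ, Finset.sum_insert hvn, ← hσ, smul_add, smul_smul, sgn_sq, one_smul]
  congr 2
  · rw [hσ, Finset.erase_insert hvn]
  · rw [img, Finset.sum_image (fun a _ b _ h => hx h), Finset.smul_sum]
    refine Finset.sum_congr rfl fun j _ => ?_
    rw [smul_smul, img_update x hx v hv j]

lemma ortho_sum {α K : Type*} [Fintype α] [Fintype K] (u : K → α → ℝ)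
    (h : ∀ a k l, u k a ≠ 0 → u l a ≠ 0 → k = l) :
    ∑ a, (∑ k, u k a) ^ 2 = ∑ k, ∑ a, u k a ^ 2 := by
  rw [Finset.sum_comm]
  refine Finset.sum_congr rfl fun a _ => ?_
  rw [sq, Finset.sum_mul_sum]
  refine Finset.sum_congr rfl fun k _ => ?_
  rw [Finset.sum_eq_single k]
  · ring
  · intro l _ hl
    by_contra hne
    exact hl (h a l k (right_ne_zero_of_mul hne) (left_ne_zero_of_mul hne))
  · simp

/-- conditions on labels -/
structure Good {n d : ℕ} (r : ℕ) (s : Shape d r) (l : Nodes d r s → Fin n) (x : Fin d → Fin n) :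
    Prop where
  inj : Function.Injective l
  xinj : Function.Injective x
  avoid : ∀ j a, x j ≠ l a

lemma Good.sub {n d r : ℕ} {s : Shape d (r + 1)} {l : Nodes d (r + 1) s → Fin n} {x : Fin d → Fin n}
    (h : Good (r + 1) s l x) (q : Fin s.1 × Fin d) :
    Good r (s.2 q) (fun a => l (Sum.inr ⟨q, a⟩)) (Function.update x q.2 (l (Sum.inl q.1))) := by
  refine ⟨?_, update_inj x h.xinj _ (fun j => h.avoid j _) _, ?_⟩
  · intro a b hab
    have := h.inj hab
    simpa using this
  · intro j a hja
    by_cases hj : j = q.2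
    · subst hj
      rw [Function.update_self] at hja
      have := h.inj hja
      simp at this
    · rw [Function.update_of_ne hj] at hja
      exact h.avoid j _ hja

theorem tree_vector {n d : ℕ} (hd : 1 ≤ d) (F : Finset (Finset (Fin n))) (r : ℕ) (s : Shape d r)
    (l : Nodes d r s → Fin n) (x : Fin d → Fin n) (hg : Good r s l x) (hA : AA r s l x ⊆ F) :
    ∃ z : Finset (Fin n) → ℝ, (ee (img x) - z) ∈ LinearMap.range (boundaryMap n F) ∧
      ∑ ρ, z ρ ^ 2 = hS d r s ∧
      ∀ ρ, z ρ ≠ 0 → ρ = img x ∨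
        ((∃ a, l a ∈ ρ) ∧ ∀ w ∈ ρ, w ∈ img x ∨ ∃ a, w = l a) := by
  induction r generalizing x with
  | zero =>
    refine ⟨ee (img x), by simp, by simp [ee, hS], ?_⟩
    intro ρ h
    left
    by_contra h2
    exact h (if_neg h2)
  | succ r ih =>
    have hAu := Finset.union_subset_iff.mp hA
    have hA1 : ∀ i, insert (l (Sum.inl i)) (img x) ∈ F := fun i =>
      hAu.1 (Finset.mem_image_of_mem _ (Finset.mem_univ i))
    have hA2 : ∀ q : Fin s.1 × Fin d, _ ⊆ F := fun q =>
      (Finset.biUnion_subset.mp hAu.2) q (Finset.mem_univ q)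
    choose z hz1 hz2 hz3 using fun q : Fin s.1 × Fin d => ih (s.2 q) _ _ (hg.sub q) (hA2 q)
    choose η hη1 hη2 using fun i : Fin s.1 => face_rel F x hg.xinj (l (Sum.inl i))
      (fun j => hg.avoid j _) (hA1 i)
    set τ := img x with hτ
    have hne : Nonempty (Fin d) := ⟨⟨0, hd⟩⟩
    let S : Fin s.1 → ℝ := fun i => ∑ j : Fin d, hS d r (s.2 (i, j))
    have hSpos : ∀ i, 0 < S i := fun i =>
      Finset.sum_pos (fun j _ => hS_pos _ _ _) Finset.univ_nonempty
    set h := hS d (r + 1) s with hh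
    have hh0 : 0 < h := hS_pos _ _ _
    have hhS : h * (1 + ∑ i, (S i)⁻¹) = 1 := by
      have : h = (1 + ∑ i, (S i)⁻¹)⁻¹ := rfl
      rw [this]
      apply inv_mul_cancel₀
      have := Finset.sum_nonneg fun i (_ : i ∈ Finset.univ) => inv_nonneg.mpr (hSpos i).le
      positivity
    let α : Fin s.1 → ℝ := fun i => h * (S i)⁻¹
    -- membership
    have hmem : ∀ i, (ee τ + ∑ j, η i j • z (i, j)) ∈ LinearMap.range (boundaryMap n F) := by
      intro i
      have h1 : (∑ j, η i j • (ee (img (Function.update x j (l (Sum.inl i)))) - z (i, j))) ∈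
          LinearMap.range (boundaryMap n F) :=
        Submodule.sum_mem _ fun j _ => Submodule.smul_mem _ _ (hz1 (i, j))
      have h2 := Submodule.sub_mem _ (hη2 i) h1
      convert h2 using 1
      simp only [smul_sub, Finset.sum_sub_distrib]
      abel
    have hmem2 : (∑ i, α i • (ee τ + ∑ j, η i j • z (i, j))) ∈ LinearMap.range (boundaryMap n F) :=
      Submodule.sum_mem _ fun i _ => Submodule.smul_mem _ _ (hmem i)
    have hαsum : ∑ i, α i = 1 - h := by
      simp only [α]
      rw [← Finset.mul_sum]; linarith
    -- support facts
    have hsup : ∀ q : Fin s.1 × Fin d, ∀ ρ, z q ρ ≠ 0 →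
        ρ = (insert (l (Sum.inl q.1)) τ).erase (x q.2) ∨
        ((∃ a, l (Sum.inr ⟨q, a⟩) ∈ ρ) ∧ ∀ w ∈ ρ, w ∈ τ ∨ w = l (Sum.inl q.1) ∨
          ∃ a, w = l (Sum.inr ⟨q, a⟩)) := by
      intro q ρ hq
      have himg := img_update x hg.xinj (l (Sum.inl q.1)) (fun j => hg.avoid j _) q.2
      rcases hz3 q ρ hq with h1 | ⟨h1, h2⟩
      · left; rw [h1, himg]
      · right
        refine ⟨h1, fun w hw => ?_⟩
        rcases h2 w hw with h3 | h3
        · rw [himg, Finset.mem_erase, Finset.mem_insert] at h3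
          tauto
        · tauto
    have hτl : ∀ a, l a ∉ τ := by
      intro a ha
      rw [hτ, mem_img] at ha
      obtain ⟨j, hj⟩ := ha
      exact hg.avoid j a hj
    have hxτ : ∀ j, x j ∈ τ := fun j => (mem_img x _).mpr ⟨j, rfl⟩
    -- every supported face contains a label
    have hlab : ∀ q ρ, z q ρ ≠ 0 → ∃ a, l a ∈ ρ := by
      intro q ρ hq
      rcases hsup q ρ hq with h1 | ⟨⟨a, h1⟩, h2⟩
      · refine ⟨Sum.inl q.1, ?_⟩
        rw [h1, Finset.mem_erase]
        exact ⟨fun h => hg.avoid _ _ h.symm, Finset.mem_insert_self _ _⟩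
      · exact ⟨_, h1⟩
    have hdisj : ∀ ρ q q', z q ρ ≠ 0 → z q' ρ ≠ 0 → q = q' := by
      have key : ∀ ρ q q', (∃ a, l (Sum.inr ⟨q, a⟩) ∈ ρ) → z q' ρ ≠ 0 → q = q' := by
        rintro ρ q q' ⟨a, ha⟩ hq'
        rcases hsup q' ρ hq' with h1 | ⟨_, h1⟩
        · rw [h1, Finset.mem_erase, Finset.mem_insert] at ha
          rcases ha.2 with h2 | h2
          · exact absurd (hg.inj h2) (by simp)
          · exact absurd h2 (hτl _)
        · rcases h1 _ ha with h2 | h2 | ⟨b, h2⟩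
          · exact absurd h2 (hτl _)
          · exact absurd (hg.inj h2) (by simp)
          · have := hg.inj h2
            simp only [Sum.inr.injEq, Sigma.mk.injEq] at this
            exact this.1
      intro ρ q q' hq hq'
      rcases hsup q ρ hq with h1 | ⟨h1, _⟩
      · rcases hsup q' ρ hq' with h2 | ⟨h2, _⟩
        · have e1 : q.1 = q'.1 := by
            have : l (Sum.inl q.1) ∈ ρ := by
              rw [h1, Finset.mem_erase]
              exact ⟨fun h => hg.avoid _ _ h.symm, Finset.mem_insert_self _ _⟩
            rw [h2, Finset.mem_erase, Finset.mem_insert] at this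
            rcases this.2 with h3 | h3
            · simpa using hg.inj h3
            · exact absurd h3 (hτl _)
          have e2 : q.2 = q'.2 := by
            by_contra hne2
            have : x q.2 ∈ ρ := by
              rw [h2, Finset.mem_erase]
              exact ⟨fun h => hne2 (hg.xinj h), Finset.mem_insert_of_mem (hxτ _)⟩
            rw [h1] at this
            exact absurd this (Finset.notMem_erase _ _)
          exact Prod.ext e1 e2
        · exact (key ρ q' q h2 hq).symm
      · exact key ρ q q' h1 hq'
    refine ⟨ee τ - ∑ i, α i • (ee τ + ∑ j, η i j • z (i, j)), by simpa using hmem2, ?_, ?_⟩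
    · -- norm
      let u : Option (Fin s.1 × Fin d) → Finset (Fin n) → ℝ := fun o ρ =>
        match o with
        | none => h * ee τ ρ
        | some q => -(α q.1 * η q.1 q.2 * z q ρ)
      have hu : ∀ ρ, (ee τ - ∑ i, α i • (ee τ + ∑ j, η i j • z (i, j))) ρ = ∑ o, u o ρ := by
        intro ρ
        rw [Fintype.sum_option, Fintype.sum_prod_type]
        simp only [Pi.sub_apply, Finset.sum_apply, Pi.smul_apply, Pi.add_apply, smul_eq_mul, u,
          mul_add, Finset.sum_add_distrib, ← Finset.sum_mul, hαsum, Finset.sum_neg_distrib,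
          Finset.mul_sum, mul_assoc]
        ring
      simp_rw [hu]
      rw [ortho_sum u]
      · rw [Fintype.sum_option, Fintype.sum_prod_type]
        have e1 : ∑ a, u none a ^ 2 = h ^ 2 := by
          simp [u, ee, mul_pow]
        have e2 : ∀ i j, ∑ a, u (some (i, j)) a ^ 2 = α i ^ 2 * hS d r (s.2 (i, j)) := by
          intro i j
          simp only [u]
          rw [← hz2 (i, j), Finset.mul_sum]
          refine Finset.sum_congr rfl fun ρ _ => ?_
          rw [neg_sq, mul_pow, mul_pow, hη1, mul_one]
        simp_rw [e1, e2, ← Finset.mul_sum]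
        have e3 : ∀ i, α i ^ 2 * ∑ j : Fin d, hS d r (s.2 (i, j)) = h ^ 2 * (S i)⁻¹ := by
          intro i
          show (h * (S i)⁻¹) ^ 2 * S i = _
          have := (hSpos i).ne'
          field_simp
        simp_rw [e3]
        rw [← Finset.mul_sum]
        calc h ^ 2 + h ^ 2 * ∑ i, (S i)⁻¹ = h * (h * (1 + ∑ i, (S i)⁻¹)) := by ring
          _ = h := by rw [hhS, mul_one]
      · intro ρ o o' ho ho'
        have hns : ∀ q, u (some q) ρ ≠ 0 → z q ρ ≠ 0 := by
          intro q hq h0; apply hq; simp [u, h0]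
        have hnn : u none ρ ≠ 0 → ρ = τ := by
          intro hq; by_contra h0; apply hq; simp [u, ee, h0]
        match o, o' with
        | none, none => rfl
        | some q, some q' => exact congrArg some (hdisj ρ q q' (hns q ho) (hns q' ho'))
        | none, some q =>
          obtain ⟨a, ha⟩ := hlab q ρ (hns q ho')
          rw [hnn ho] at ha; exact absurd ha (hτl a)
        | some q, none =>
          obtain ⟨a, ha⟩ := hlab q ρ (hns q ho)
          rw [hnn ho'] at ha; exact absurd ha (hτl a)
    · intro ρ hρ
      by_cases hρτ : ρ = τ
      · exact Or.inl hρτ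
      right
      have : ∃ q, z q ρ ≠ 0 := by
        by_contra hcon
        push Not at hcon
        apply hρ
        simp [ee, hρτ, hcon]
      obtain ⟨q, hq⟩ := this
      refine ⟨hlab q ρ hq, fun w hw => ?_⟩
      rcases hsup q ρ hq with h1 | ⟨_, h2⟩
      · rw [h1, Finset.mem_erase, Finset.mem_insert] at hw
        rcases hw.2 with h3 | h3
        · exact Or.inr ⟨_, h3⟩
        · exact Or.inl h3
      · rcases h2 w hw with h3 | h3 | ⟨a, h3⟩
        · exact Or.inl h3
        · exact Or.inr ⟨_, h3⟩
        · exact Or.inr ⟨_, h3⟩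

theorem hF_le_hS {n d : ℕ} (hd : 1 ≤ d) (F : Finset (Finset (Fin n))) (r : ℕ) (s : Shape d r)
    (l : Nodes d r s → Fin n) (x : Fin d → Fin n) (hg : Good r s l x) (hA : AA r s l x ⊆ F) :
    hF F (img x) ≤ hS d r s := by
  obtain ⟨z, h1, h2, _⟩ := tree_vector hd F r s l x hg hA
  refine (hF_le F _ _ h1).trans (le_of_eq ?_)
  rw [← h2]
  refine Finset.sum_congr rfl fun ρ _ => ?_
  simp [ee]

end LP

namespace LP

lemma finite_Nodes (d r : ℕ) (s : Shape d r) : Finite (Nodes d r s) := by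
  induction r with
  | zero => exact inferInstanceAs (Finite Empty)
  | succ r ih =>
    have := ih
    exact inferInstanceAs (Finite (Fin s.1 ⊕ (Σ q : Fin s.1 × Fin d, Nodes d r (s.2 q))))

instance fintypeNodes (d r : ℕ) (s : Shape d r) : Fintype (Nodes d r s) :=
  @Fintype.ofFinite _ (finite_Nodes d r s)

/-- number of nodes -/
def eS (d : ℕ) : (r : ℕ) → Shape d r → ℕ
  | 0, _ => 0
  | r + 1, s => s.1 + ∑ q, eS d r (s.2 q)

/-- number of inner nodes -/
def iS (d : ℕ) : (r : ℕ) → Shape d r → ℕ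
  | 0, _ => 0
  | r + 1, s => 1 + ∑ q, iS d r (s.2 q)

/-- symmetry factor -/
def fS (d : ℕ) : (r : ℕ) → Shape d r → ℕ
  | 0, _ => 1
  | r + 1, s => s.1.factorial * ∏ q, fS d r (s.2 q)

lemma fS_pos (d r : ℕ) (s : Shape d r) : 0 < fS d r s := by
  induction r with
  | zero => exact Nat.one_pos
  | succ r ih => exact Nat.mul_pos (Nat.factorial_pos _) (Finset.prod_pos fun q _ => ih _)

lemma card_Nodes (d r : ℕ) (s : Shape d r) : Fintype.card (Nodes d r s) = eS d r s := by
  rw [← Nat.card_eq_fintype_card]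
  induction r with
  | zero => simp [eS]
  | succ r ih =>
    show Nat.card (Fin s.1 ⊕ (Σ q : Fin s.1 × Fin d, Nodes d r (s.2 q))) = _
    have := finite_Nodes d r
    rw [Nat.card_sum, Nat.card_sigma]
    simp only [ih, eS, Nat.card_fin]

lemma wS_eq (d : ℕ) (c : ℝ) (r : ℕ) (s : Shape d r) :
    wS d c r s = c ^ eS d r s * Real.exp (-c) ^ iS d r s / fS d r s := by
  induction r with
  | zero => simp [wS, eS, iS, fS]
  | succ r ih =>
    simp only [wS, eS, iS, fS, ih]
    rw [Finset.prod_div_distrib, Finset.prod_mul_distrib, Finset.prod_pow_eq_pow_sum,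
      Finset.prod_pow_eq_pow_sum]
    push_cast
    rw [pow_add, pow_add, pow_one, div_mul_div_comm]
    ring

/-- faces required to be absent -/
def BB {n d : ℕ} : (r : ℕ) → (s : Shape d r) → (Nodes d r s → Fin n) → (Fin d → Fin n) → Fin n →
    Finset (Finset (Fin n))
  | 0, _, _, _, _ => ∅
  | r + 1, s, l, x, ex =>
      ((Finset.univ.filter fun w : Fin n => w ∉ img x ∧ w ≠ ex ∧ ∀ i : Fin s.1, w ≠ l (Sum.inl i)).image
        fun w => insert w (img x)) ∪
      Finset.univ.biUnion fun q : Fin s.1 × Fin d => BB r (s.2 q) (fun a => l (Sum.inr ⟨q, a⟩))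
        (Function.update x q.2 (l (Sum.inl q.1))) (x q.2)

lemma card_AA {n d : ℕ} (r : ℕ) (s : Shape d r) (l : Nodes d r s → Fin n) (x : Fin d → Fin n) :
    (AA r s l x).card ≤ eS d r s := by
  induction r generalizing x with
  | zero => simp [AA]
  | succ r ih =>
    unfold AA
    refine (Finset.card_union_le _ _).trans ?_
    show _ ≤ s.1 + ∑ q, eS d r (s.2 q)
    refine add_le_add ?_ ?_
    · exact Finset.card_image_le.trans (by simp)
    · exact Finset.card_biUnion_le.trans (Finset.sum_le_sum fun q _ => ih _ _ _)

lemma card_BB {n d : ℕ} (r : ℕ) (s : Shape d r) (l : Nodes d r s → Fin n) (x : Fin d → Fin n)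
    (ex : Fin n) : (BB r s l x ex).card ≤ n * iS d r s := by
  induction r generalizing x ex with
  | zero => simp [BB]
  | succ r ih =>
    unfold BB
    refine (Finset.card_union_le _ _).trans ?_
    show _ ≤ n * (1 + ∑ q, iS d r (s.2 q))
    rw [mul_add, mul_one, Finset.mul_sum]
    refine add_le_add ?_ ?_
    · exact Finset.card_image_le.trans ((Finset.card_filter_le _ _).trans (by simp))
    · exact Finset.card_biUnion_le.trans (Finset.sum_le_sum fun q _ => ih _ _ _ _)

lemma card_img {n d : ℕ} (x : Fin d → Fin n) (hx : Function.Injective x) : (img x).card = d := by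
  rw [img, Finset.card_image_of_injective _ hx]; simp

lemma Good.notMem {n d r : ℕ} {s : Shape d r} {l : Nodes d r s → Fin n} {x : Fin d → Fin n}
    (h : Good r s l x) (a) : l a ∉ img x := by
  rw [mem_img]; rintro ⟨j, hj⟩; exact h.avoid j a hj

lemma AA_fact {n d : ℕ} (r : ℕ) (s : Shape d r) (l : Nodes d r s → Fin n) (x : Fin d → Fin n)
    (hg : Good r s l x) (σ) (hσ : σ ∈ AA r s l x) :
    σ.card = d + 1 ∧ (∃ a, l a ∈ σ) ∧ ∀ w ∈ σ, w ∈ img x ∨ ∃ a, w = l a := by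
  induction r generalizing x with
  | zero => simp [AA] at hσ
  | succ r ih =>
    unfold AA at hσ
    rw [Finset.mem_union, Finset.mem_image, Finset.mem_biUnion] at hσ
    rcases hσ with ⟨i, _, rfl⟩ | ⟨q, _, hq⟩
    · refine ⟨?_, ⟨_, Finset.mem_insert_self _ _⟩, ?_⟩
      · rw [Finset.card_insert_of_notMem (hg.notMem _), card_img x hg.xinj]
      · intro w hw
        rw [Finset.mem_insert] at hw
        rcases hw with h | h
        · exact Or.inr ⟨_, h⟩
        · exact Or.inl h
    · obtain ⟨h1, ⟨a, h2⟩, h3⟩ := ih _ _ _ (hg.sub q) hq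
      refine ⟨h1, ⟨_, h2⟩, ?_⟩
      intro w hw
      rcases h3 w hw with h | ⟨b, h⟩
      · rw [img_update x hg.xinj _ (fun j => hg.avoid j _), Finset.mem_erase, Finset.mem_insert] at h
        rcases h.2 with h | h
        · exact Or.inr ⟨_, h⟩
        · exact Or.inl h
      · exact Or.inr ⟨_, h⟩

lemma BB_fact {n d : ℕ} (r : ℕ) (s : Shape d r) (l : Nodes d r s → Fin n) (x : Fin d → Fin n)
    (ex : Fin n) (hg : Good r s l x) (σ) (hσ : σ ∈ BB r s l x ex) :
    σ.card = d + 1 ∧ ((∃ a, l a ∈ σ) ∨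
      ∃ w, w ∉ img x ∧ w ≠ ex ∧ σ = insert w (img x)) := by
  induction r generalizing x ex with
  | zero => simp [BB] at hσ
  | succ r ih =>
    unfold BB at hσ
    rw [Finset.mem_union, Finset.mem_image, Finset.mem_biUnion] at hσ
    rcases hσ with ⟨w, hw, rfl⟩ | ⟨q, _, hq⟩
    · rw [Finset.mem_filter] at hw
      refine ⟨?_, Or.inr ⟨w, hw.2.1, hw.2.2.1, rfl⟩⟩
      rw [Finset.card_insert_of_notMem hw.2.1, card_img x hg.xinj]
    · obtain ⟨h1, h2⟩ := ih _ _ _ _ (hg.sub q) hq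
      refine ⟨h1, Or.inl ?_⟩
      rcases h2 with ⟨a, h⟩ | ⟨w, h3, h4, h5⟩
      · exact ⟨_, h⟩
      · refine ⟨Sum.inl q.1, ?_⟩
        rw [h5]
        refine Finset.mem_insert_of_mem ?_
        rw [mem_img]
        exact ⟨q.2, by simp⟩

lemma AB_disj {n d : ℕ} (r : ℕ) (s : Shape d r) (l : Nodes d r s → Fin n) (x : Fin d → Fin n)
    (ex : Fin n) (hg : Good r s l x) (σ) (hA : σ ∈ AA r s l x) (hB : σ ∈ BB r s l x ex) : False := by
  induction r generalizing x ex with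
  | zero => simp [AA] at hA
  | succ r ih =>
    have hxi : ∀ j, x j ∈ img x := fun j => (mem_img x _).mpr ⟨j, rfl⟩
    have himg := fun q : Fin s.1 × Fin d =>
      img_update x hg.xinj (l (Sum.inl q.1)) (fun j => hg.avoid j _) q.2
    -- faces of A in a subtree
    have hAsub : ∀ q : Fin s.1 × Fin d, σ ∈ AA r (s.2 q) (fun a => l (Sum.inr ⟨q, a⟩))
        (Function.update x q.2 (l (Sum.inl q.1))) → (∃ a, l (Sum.inr ⟨q, a⟩) ∈ σ) ∧
        x q.2 ∉ σ ∧ ∀ w ∈ σ, w ∈ img x ∨ w = l (Sum.inl q.1) ∨ ∃ a, w = l (Sum.inr ⟨q, a⟩) := by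
      intro q hq
      obtain ⟨_, h2, h3⟩ := AA_fact _ _ _ _ (hg.sub q) _ hq
      refine ⟨h2, ?_, ?_⟩
      · intro hx
        rcases h3 _ hx with h | ⟨a, h⟩
        · rw [himg] at h; exact Finset.notMem_erase _ _ h
        · exact hg.avoid _ _ h
      · intro w hw
        rcases h3 _ hw with h | h
        · rw [himg, Finset.mem_erase, Finset.mem_insert] at h; tauto
        · tauto
    have hBsub : ∀ q : Fin s.1 × Fin d, σ ∈ BB r (s.2 q) (fun a => l (Sum.inr ⟨q, a⟩))
        (Function.update x q.2 (l (Sum.inl q.1))) (x q.2) → (∃ a, l (Sum.inr ⟨q, a⟩) ∈ σ) ∨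
        (x q.2 ∉ σ ∧ l (Sum.inl q.1) ∈ σ ∧ ∀ j, j ≠ q.2 → x j ∈ σ) := by
      intro q hq
      obtain ⟨_, h | ⟨w, h1, h2, h3⟩⟩ := BB_fact _ _ _ _ _ (hg.sub q) _ hq
      · exact Or.inl h
      · right
        rw [himg] at h3
        subst h3
        refine ⟨?_, ?_, ?_⟩
        · rw [Finset.mem_insert]
          rintro (h | h)
          · exact h2 h.symm
          · exact Finset.notMem_erase _ _ h
        · refine Finset.mem_insert_of_mem (Finset.mem_erase.mpr ⟨fun h => hg.avoid _ _ h.symm, ?_⟩)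
          exact Finset.mem_insert_self _ _
        · intro j hj
          refine Finset.mem_insert_of_mem (Finset.mem_erase.mpr ⟨fun h => hj (hg.xinj h), ?_⟩)
          exact Finset.mem_insert_of_mem (hxi j)
    unfold AA at hA
    unfold BB at hB
    rw [Finset.mem_union, Finset.mem_image, Finset.mem_biUnion] at hA hB
    rcases hA with ⟨i, _, hi⟩ | ⟨q, _, hq⟩
    · rcases hB with ⟨w, hw, hw2⟩ | ⟨q, _, hq⟩
      · rw [Finset.mem_filter] at hw
        have : w ∈ insert (l (Sum.inl i)) (img x) := by rw [hi, ← hw2]; exact Finset.mem_insert_self _ _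
        rw [Finset.mem_insert] at this
        rcases this with h | h
        · exact hw.2.2.2 i h
        · exact hw.2.1 h
      · rcases hBsub q hq with ⟨a, ha⟩ | ⟨h, _⟩
        · rw [← hi, Finset.mem_insert] at ha
          rcases ha with h | h
          · exact absurd (hg.inj h) (by simp)
          · exact hg.notMem _ h
        · apply h; rw [← hi]; exact Finset.mem_insert_of_mem (hxi _)
    · obtain ⟨_, h2, h3⟩ := hAsub q hq
      rcases hB with ⟨w, hw, hw2⟩ | ⟨q', _, hq'⟩
      · apply h2; rw [← hw2]; exact Finset.mem_insert_of_mem (hxi _)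
      · by_cases hqq : q = q'
        · subst hqq
          exact ih _ _ _ _ (hg.sub q) hq hq'
        · rcases hBsub q' hq' with ⟨a, ha⟩ | ⟨h4, h5, h6⟩
          · rcases h3 _ ha with h | h | ⟨b, h⟩
            · exact hg.notMem _ h
            · exact absurd (hg.inj h) (by simp)
            · have := hg.inj h
              simp only [Sum.inr.injEq, Sigma.mk.injEq] at this
              exact hqq this.1.symm
          · have e1 : q'.1 = q.1 := by
              rcases h3 _ h5 with h | h | ⟨b, h⟩
              · exact absurd h (hg.notMem _)
              · simpa using hg.inj h
              · exact absurd (hg.inj h) (by simp)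
            have e2 : q.2 = q'.2 := by
              by_contra hne
              exact h2 (h6 _ hne)
            exact hqq (Prod.ext e1.symm e2)

end LP

namespace LP

/-- link -/
def lnk {n d : ℕ} (F : Finset (Finset (Fin n))) (x : Fin d → Fin n) (ex : Fin n) : Finset (Fin n) :=
  Finset.univ.filter fun w => w ∉ img x ∧ w ≠ ex ∧ insert w (img x) ∈ F

/-- relaxed matching predicate -/
def RR {n d : ℕ} (F : Finset (Finset (Fin n))) : (r : ℕ) → (s : Shape d r) → (Nodes d r s → Fin n) →
    (Fin d → Fin n) → Fin n → Prop
  | 0, _, _, _, _ => True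
  | r + 1, s, l, x, ex =>
      (Function.Injective (fun i : Fin s.1 => l (Sum.inl i)) ∧
        Finset.univ.image (fun i : Fin s.1 => l (Sum.inl i)) = lnk F x ex) ∧
      ∀ q : Fin s.1 × Fin d, RR F r (s.2 q) (fun a => l (Sum.inr ⟨q, a⟩))
        (Function.update x q.2 (l (Sum.inl q.1))) (x q.2)

lemma RR_of {n d : ℕ} (F : Finset (Finset (Fin n))) (r : ℕ) (s : Shape d r) (l : Nodes d r s → Fin n)
    (x : Fin d → Fin n) (ex : Fin n) (hg : Good r s l x) (hex : ∀ a, l a ≠ ex)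
    (hA : AA r s l x ⊆ F) (hB : Disjoint F (BB r s l x ex)) : RR F r s l x ex := by
  induction r generalizing x ex with
  | zero => trivial
  | succ r ih =>
    unfold AA at hA
    unfold BB at hB
    rw [Finset.disjoint_union_right] at hB
    have hAu := Finset.union_subset_iff.mp hA
    refine ⟨⟨?_, ?_⟩, ?_⟩
    · intro a b h
      simpa using hg.inj h
    · ext w
      simp only [Finset.mem_image, Finset.mem_univ, true_and, lnk, Finset.mem_filter]
      constructor
      · rintro ⟨i, rfl⟩
        exact ⟨hg.notMem _, hex _, hAu.1 (Finset.mem_image_of_mem _ (Finset.mem_univ i))⟩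
      · rintro ⟨h1, h2, h3⟩
        by_contra hcon
        push Not at hcon
        refine Finset.disjoint_left.mp hB.1 h3 (Finset.mem_image_of_mem _ ?_)
        rw [Finset.mem_filter]
        exact ⟨Finset.mem_univ _, h1, h2, fun i h => hcon i h.symm⟩
    · intro q
      refine ih _ _ _ _ (hg.sub q) (fun a h => hg.avoid _ _ h.symm)
        ((Finset.biUnion_subset.mp hAu.2) q (Finset.mem_univ q)) ?_
      exact (Finset.disjoint_biUnion_right _ _ _).mp hB.2 q (Finset.mem_univ q)

lemma inj_count {n : ℕ} (m : ℕ) (L : Finset (Fin n)) :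
    ∑ l : Fin m → Fin n, (if Function.Injective l ∧ Finset.univ.image l = L then (1 : ℝ) else 0) ≤
      if m = L.card then (m.factorial : ℝ) else 0 := by
  split_ifs with h
  · rw [Finset.sum_boole]
    norm_cast
    rw [← Fintype.card_coe]
    have h2 : Fintype.card (Fin m ↪ L) = m.factorial := by
      rw [Fintype.card_embedding_eq]; simp [← h, Nat.descFactorial_self]
    rw [← h2]
    refine Fintype.card_le_of_injective
      (fun l => ⟨fun i => ⟨l.1 i, ?_⟩, ?_⟩) ?_
    · have := (Finset.mem_filter.mp l.2).2.2
      have h3 := Finset.mem_image_of_mem l.1 (Finset.mem_univ i)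
      generalize l.1 i = y at h3 ⊢
      exact this.le h3
    · intro a b hab
      exact (Finset.mem_filter.mp l.2).2.1 (by simpa using hab)
    · intro a b hab
      ext i
      have := congrArg (fun e => ((e i : L) : Fin n)) hab
      exact congrArg Fin.val this
  · apply le_of_eq
    apply Finset.sum_eq_zero
    intro l _
    rw [if_neg]
    rintro ⟨h1, rfl⟩
    apply h
    rw [Finset.card_image_of_injective _ h1]; simp

/-- splitting labels -/
def splitL (n d r : ℕ) (s : Shape d (r + 1)) : (Nodes d (r + 1) s → Fin n) ≃
    (Fin s.1 → Fin n) × ((q : Fin s.1 × Fin d) → Nodes d r (s.2 q) → Fin n) where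
  toFun l := (fun i => l (Sum.inl i), fun q a => l (Sum.inr ⟨q, a⟩))
  invFun p := Sum.elim p.1 (fun a => p.2 a.1 a.2)
  left_inv l := by
    funext a
    rcases a with i | ⟨q, a⟩ <;> rfl
  right_inv p := rfl

lemma sum_equiv_aux {α β : Type*} (i1 : Fintype α) (i2 : Fintype β) (e : α ≃ β) (f : α → ℝ)
    (g : β → ℝ) (h : ∀ a, f a = g (e a)) : ∑ a, f a = ∑ b, g b := Fintype.sum_equiv e f g h

/-- weighted number of matchings -/
def WW {n d : ℕ} (F : Finset (Finset (Fin n))) (r : ℕ) (s : Shape d r) (x : Fin d → Fin n)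
    (ex : Fin n) : ℝ :=
  ∑ l : Nodes d r s → Fin n, (if RR F r s l x ex then ((fS d r s : ℝ))⁻¹ else 0)

lemma WW_nonneg {n d : ℕ} (F : Finset (Finset (Fin n))) (r : ℕ) (s : Shape d r) (x : Fin d → Fin n)
    (ex : Fin n) : 0 ≤ WW F r s x ex := by
  refine Finset.sum_nonneg fun l _ => ?_
  split_ifs <;> positivity

lemma RR_sum {n d : ℕ} (F : Finset (Finset (Fin n))) (M r : ℕ) (x : Fin d → Fin n) (ex : Fin n) :
    ∑ s ∈ Box d M r, WW F r s x ex ≤ 1 := by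
  induction r generalizing x ex with
  | zero => simp [Box, WW, RR, fS]
  | succ r ih =>
    have key : ∀ (m : ℕ) (f : Fin m × Fin d → Shape d r),
        WW F (r + 1) ⟨m, f⟩ x ex =
        ∑ l : Fin m → Fin n, (if Function.Injective l ∧ Finset.univ.image l = lnk F x ex then
          ((m.factorial : ℝ))⁻¹ else 0) * ∏ q : Fin m × Fin d,
            WW F r (f q) (Function.update x q.2 (l q.1)) (x q.2) := by
      intro m f
      unfold WW
      let i2 : Fintype ((Fin m → Fin n) × ((q : Fin m × Fin d) → Nodes d r (f q) → Fin n)) := inferInstance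
      refine (sum_equiv_aux _ i2 (splitL n d r ⟨m, f⟩) _ (fun p : (Fin m → Fin n) × ((q : Fin m × Fin d) → Nodes d r (f q) → Fin n) =>
        (if Function.Injective p.1 ∧ Finset.univ.image p.1 = lnk F x ex then
          ((m.factorial : ℝ))⁻¹ else 0) * ∏ q : Fin m × Fin d,
              (if RR F r (f q) (p.2 q) (Function.update x q.2 (p.1 q.1)) (x q.2) then
                ((fS d r (f q) : ℝ))⁻¹ else 0)) ?_).trans ?_
      · intro l
        by_cases h : RR F (r + 1) ⟨m, f⟩ l x ex
        · rw [if_pos h]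
          obtain ⟨h1, h2⟩ := h
          have h1' : Function.Injective (splitL n d r ⟨m, f⟩ l).1 ∧
            Finset.univ.image (splitL n d r ⟨m, f⟩ l).1 = lnk F x ex := h1
          have h2' : ∀ q : Fin m × Fin d, RR F r (f q) ((splitL n d r ⟨m, f⟩ l).2 q)
            (Function.update x q.2 ((splitL n d r ⟨m, f⟩ l).1 q.1)) (x q.2) := h2
          rw [if_pos h1', Finset.prod_congr rfl fun q _ => if_pos (h2' q)]
          simp only [fS]
          push_cast
          rw [mul_inv, Finset.prod_inv_distrib]
        · rw [if_neg h]
          symm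
          by_contra hne
          apply h
          have a1 := left_ne_zero_of_mul hne
          have a2 := right_ne_zero_of_mul hne
          rw [Finset.prod_ne_zero_iff] at a2
          refine ⟨?_, fun q => ?_⟩
          · by_contra hh; exact a1 (if_neg hh)
          · by_contra hh; exact a2 q (Finset.mem_univ q) (if_neg hh)
      · rw [Fintype.sum_prod_type]
        refine Finset.sum_congr rfl fun l _ => ?_
        rw [Finset.prod_univ_sum, Fintype.piFinset_univ, Finset.mul_sum]
    simp only [Box]
    rw [Finset.sum_sigma]
    rw [Finset.sum_congr rfl fun m _ => Finset.sum_congr rfl fun f _ => key m f]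
    calc _ ≤ ∑ m ∈ Finset.range (M + 1), (if m = (lnk F x ex).card then (1 : ℝ) else 0) := by
          refine Finset.sum_le_sum fun m _ => ?_
          rw [Finset.sum_comm]
          calc _ ≤ ∑ l : Fin m → Fin n, (if Function.Injective l ∧ Finset.univ.image l = lnk F x ex then
                (1 : ℝ) else 0) * ((m.factorial : ℝ))⁻¹ := by
                refine Finset.sum_le_sum fun l _ => ?_
                rw [← Finset.mul_sum]
                rw [← Finset.prod_univ_sum (fun _ : Fin m × Fin d => Box d M r)
                  (fun q sq => WW F r sq (Function.update x q.2 (l q.1)) (x q.2))]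
                split_ifs
                swap
                · simp
                rw [one_mul]
                refine mul_le_of_le_one_right (by positivity) ?_
                refine Finset.prod_le_one (fun q _ => ?_) (fun q _ => ih _ _)
                exact Finset.sum_nonneg fun s _ => WW_nonneg _ _ _ _ _
            _ ≤ (if m = (lnk F x ex).card then (m.factorial : ℝ) else 0) * ((m.factorial : ℝ))⁻¹ := by
                rw [← Finset.sum_mul]
                exact mul_le_mul_of_nonneg_right (inj_count m _) (by positivity)
            _ ≤ _ := by
                split_ifs
                · rw [mul_inv_cancel₀]; positivity
                · simp
      _ ≤ 1 := by
          rw [Finset.sum_ite_eq']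
          split_ifs <;> norm_num

lemma pointwise {n d : ℕ} (hd : 1 ≤ d) (F : Finset (Finset (Fin n))) (M r : ℕ) (x : Fin d → Fin n) :
    ∑ s ∈ Box d M r, ∑ l : Nodes d r s → Fin n,
      (if Good r s l x ∧ AA r s l x ⊆ F ∧ Disjoint F (BB r s l x (x ⟨0, hd⟩)) then
        ((fS d r s : ℝ))⁻¹ * (1 - hS d r s) else 0) ≤ 1 - hF F (img x) := by
  have h0 : 0 ≤ 1 - hF F (img x) := by linarith [hF_le_one F (img x)]
  calc _ ≤ ∑ s ∈ Box d M r, ∑ l : Nodes d r s → Fin n,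
        (if RR F r s l x (x ⟨0, hd⟩) then ((fS d r s : ℝ))⁻¹ else 0) * (1 - hF F (img x)) := by
        refine Finset.sum_le_sum fun s _ => Finset.sum_le_sum fun l _ => ?_
        split_ifs with h h1 h1
        · have := hF_le_hS hd F r s l x h.1 h.2.1
          gcongr
        · exact absurd (RR_of F r s l x _ h.1 (fun a h2 => h.1.avoid _ _ h2.symm) h.2.1 h.2.2) h1
        · positivity
        · simp
    _ = (∑ s ∈ Box d M r, ∑ l : Nodes d r s → Fin n,
        (if RR F r s l x (x ⟨0, hd⟩) then ((fS d r s : ℝ))⁻¹ else 0)) * (1 - hF F (img x)) := by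
        simp_rw [← Finset.sum_mul]
    _ ≤ 1 * (1 - hF F (img x)) := mul_le_mul_of_nonneg_right (RR_sum F M r x _) h0
    _ = _ := one_mul _

lemma expect_match (n d : ℕ) (p : ℝ) (A B : Finset (Finset (Fin n))) (hA : A ⊆ allFaces n d)
    (hB : B ⊆ allFaces n d) (hAB : Disjoint A B) :
    expectY n d p (fun F => if A ⊆ F ∧ Disjoint F B then 1 else 0) = p ^ A.card * (1 - p) ^ B.card := by
  unfold expectY
  have h := Finset.prod_add (fun i => if i ∈ B then 0 else p) (fun i => if i ∈ A then 0 else 1 - p)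
    (allFaces n d)
  have h1 : ∏ i ∈ allFaces n d, ((if i ∈ B then 0 else p) + (if i ∈ A then 0 else 1 - p)) =
      p ^ A.card * (1 - p) ^ B.card := by
    have : ∀ i ∈ allFaces n d, ((if i ∈ B then 0 else p) + (if i ∈ A then 0 else 1 - p)) =
        (if i ∈ A then p else 1) * (if i ∈ B then 1 - p else 1) := by
      intro i _
      have := fun h1 : i ∈ A => fun h2 : i ∈ B => Finset.disjoint_left.mp hAB h1 h2
      split_ifs <;> first | (exfalso; tauto) | ring
    rw [Finset.prod_congr rfl this, Finset.prod_mul_distrib, Finset.prod_ite_mem, Finset.prod_ite_mem,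
      Finset.inter_eq_right.mpr hA, Finset.inter_eq_right.mpr hB]
    simp
  rw [← h1, h]
  refine Finset.sum_congr rfl fun F hF => ?_
  rw [Finset.mem_powerset] at hF
  dsimp only
  by_cases hc : A ⊆ F ∧ Disjoint F B
  · rw [if_pos hc, mul_one]
    rw [Finset.prod_congr rfl (g := fun _ => p), Finset.prod_congr (s₁ := allFaces n d \ F) rfl (g := fun _ => 1 - p)]
    · simp [Finset.card_sdiff_of_subset hF]
    · intro i hi
      rw [if_neg]
      intro hiA
      exact (Finset.mem_sdiff.mp hi).2 (hc.1 hiA)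
    · intro i hi
      rw [if_neg]
      exact fun hiB => Finset.disjoint_left.mp hc.2 hi hiB
  · rw [if_neg hc, mul_zero]
    symm
    by_contra hne
    apply hc
    have a1 := Finset.prod_ne_zero_iff.mp (left_ne_zero_of_mul hne)
    have a2 := Finset.prod_ne_zero_iff.mp (right_ne_zero_of_mul hne)
    refine ⟨fun i hi => ?_, Finset.disjoint_left.mpr fun i hi hiB => a1 i hi (if_pos hiB)⟩
    by_contra hcon
    exact a2 i (Finset.mem_sdiff.mpr ⟨hA hi, hcon⟩) (if_pos hi)

lemma expect_mono (n d : ℕ) (p : ℝ) (hp0 : 0 ≤ p) (hp1 : p ≤ 1) (X Y : Finset (Finset (Fin n)) → ℝ)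
    (h : ∀ F, F ⊆ allFaces n d → X F ≤ Y F) : expectY n d p X ≤ expectY n d p Y := by
  unfold expectY
  refine Finset.sum_le_sum fun F hF => ?_
  have : 0 ≤ 1 - p := by linarith
  exact mul_le_mul_of_nonneg_left (h F (Finset.mem_powerset.mp hF)) (by positivity)

lemma expect_sum {ι : Type*} (n d : ℕ) (p : ℝ) (S : Finset ι) (X : ι → Finset (Finset (Fin n)) → ℝ) :
    expectY n d p (fun F => ∑ i ∈ S, X i F) = ∑ i ∈ S, expectY n d p (X i) := by
  unfold expectY
  rw [Finset.sum_comm]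
  refine Finset.sum_congr rfl fun F _ => ?_
  rw [Finset.mul_sum]

lemma expect_mul (n d : ℕ) (p a : ℝ) (X : Finset (Finset (Fin n)) → ℝ) :
    expectY n d p (fun F => a * X F) = a * expectY n d p X := by
  unfold expectY
  rw [Finset.mul_sum]
  refine Finset.sum_congr rfl fun F _ => ?_
  ring

lemma good_count {n d r : ℕ} (s : Shape d r) (x : Fin d → Fin n) (hx : Function.Injective x) :
    (Finset.univ.filter fun l : Nodes d r s → Fin n => Good r s l x).card =
      (n - d).descFactorial (eS d r s) := by
  have hc : Fintype.card {w : Fin n // w ∉ img x} = n - d := by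
    rw [Fintype.card_subtype_compl]; simp [card_img x hx]
  rw [← hc, ← card_Nodes, ← Fintype.card_embedding_eq, ← Fintype.card_coe]
  refine Fintype.card_congr ⟨fun l => ⟨fun a => ⟨l.1 a, ?_⟩, ?_⟩, fun e => ⟨fun a => (e a).1, ?_⟩, ?_, ?_⟩
  · exact (Finset.mem_filter.mp l.2).2.notMem a
  · intro a b hab
    exact (Finset.mem_filter.mp l.2).2.inj (by simpa using hab)
  · rw [Finset.mem_filter]
    refine ⟨Finset.mem_univ _, fun a b h => e.injective (Subtype.ext h), hx, ?_⟩
    intro j a h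
    exact (e a).2 ((mem_img x _).mpr ⟨j, h⟩)
  · intro l; rfl
  · intro e; rfl

theorem expect_lower {n d : ℕ} (hd : 1 ≤ d) (p : ℝ) (hp0 : 0 ≤ p) (hp1 : p ≤ 1) (M r : ℕ)
    (x : Fin d → Fin n) (hx : Function.Injective x) :
    ∑ s ∈ Box d M r, (1 - hS d r s) / fS d r s *
      ((n - d).descFactorial (eS d r s) * p ^ eS d r s * (1 - p) ^ (n * iS d r s)) ≤
      expectY n d p (fun F => 1 - hF F (img x)) := by
  refine le_trans ?_ (expect_mono n d p hp0 hp1 _ _ fun F _ => pointwise hd F M r x)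
  rw [expect_sum]
  refine Finset.sum_le_sum fun s _ => ?_
  rw [expect_sum]
  have h1p : 0 ≤ 1 - p := by linarith
  have hh : 0 ≤ 1 - hS d r s := by linarith [hS_le_one d r s]
  calc _ = ∑ l ∈ Finset.univ.filter (fun l : Nodes d r s → Fin n => Good r s l x),
        ((1 - hS d r s) / fS d r s * (p ^ eS d r s * (1 - p) ^ (n * iS d r s))) := by
        rw [Finset.sum_const, good_count s x hx, nsmul_eq_mul]; ring
    _ = ∑ l : Nodes d r s → Fin n, if Good r s l x then
        ((1 - hS d r s) / fS d r s * (p ^ eS d r s * (1 - p) ^ (n * iS d r s))) else 0 := by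
        rw [Finset.sum_filter]
    _ ≤ _ := by
        refine Finset.sum_le_sum fun l _ => ?_
        by_cases hg : Good r s l x
        · rw [if_pos hg]
          have : (fun F : Finset (Finset (Fin n)) => if Good r s l x ∧ AA r s l x ⊆ F ∧
              Disjoint F (BB r s l x (x ⟨0, hd⟩)) then ((fS d r s : ℝ))⁻¹ * (1 - hS d r s) else 0) =
              fun F => ((1 - hS d r s) / fS d r s) * (if AA r s l x ⊆ F ∧
              Disjoint F (BB r s l x (x ⟨0, hd⟩)) then 1 else 0) := by
            funext F
            simp only [hg, true_and, mul_ite, mul_one, mul_zero]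
            congr 1
            ring
          rw [this, expect_mul, expect_match]
          · refine mul_le_mul_of_nonneg_left ?_ (by positivity)
            refine mul_le_mul (pow_le_pow_of_le_one hp0 hp1 (card_AA _ _ _ _))
              (pow_le_pow_of_le_one h1p (by linarith) (card_BB _ _ _ _ _)) (by positivity) (by positivity)
          · intro σ hσ
            simp only [allFaces, Finset.mem_filter, Finset.mem_univ, true_and]
            exact (AA_fact r s l x hg σ hσ).1
          · intro σ hσ
            simp only [allFaces, Finset.mem_filter, Finset.mem_univ, true_and]
            exact (BB_fact r s l x _ hg σ hσ).1
          · exact Finset.disjoint_left.mpr fun σ h1 h2 => AB_disj r s l x _ hg σ h1 h2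
        · rw [if_neg hg]
          simp [hg, expectY]

end LP

namespace LP
open scoped NNReal ENNReal

lemma tendsto_sub_div (c : ℝ) (k : ℕ) :
    Tendsto (fun n : ℕ => ((n - k : ℕ) : ℝ) * (c / n)) atTop (nhds c) := by
  have h : Tendsto (fun n : ℕ => c - k * c / (n : ℝ)) atTop (nhds (c - 0)) :=
    tendsto_const_nhds.sub (tendsto_const_div_atTop_nhds_zero_nat _)
  rw [sub_zero] at h
  refine h.congr' ?_
  filter_upwards [eventually_ge_atTop (k + 1)] with n hn
  have : (n : ℝ) ≠ 0 := by
    have : 0 < n := by omega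
    positivity
  rw [Nat.cast_sub (by omega)]
  field_simp

lemma tendsto_desc (c : ℝ) (d e : ℕ) :
    Tendsto (fun n : ℕ => ((n - d).descFactorial e : ℝ) * (c / n) ^ e) atTop (nhds (c ^ e)) := by
  induction e with
  | zero => simp
  | succ e ih =>
    have h := (tendsto_sub_div c (d + e)).mul ih
    rw [pow_succ']
    refine h.congr fun n => ?_
    rw [Nat.descFactorial_succ, Nat.sub_sub]
    push_cast
    ring

lemma tendsto_box (d M r : ℕ) (c : ℝ) :
    Tendsto (fun n : ℕ => ∑ s ∈ Box d M r, (1 - hS d r s) / fS d r s *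
      ((n - d).descFactorial (eS d r s) * (c / n) ^ eS d r s * (1 - c / n) ^ (n * iS d r s))) atTop
      (nhds (∑ s ∈ Box d M r, wS d c r s * (1 - hS d r s))) := by
  refine tendsto_finsetSum _ fun s _ => ?_
  have h1 := tendsto_desc c d (eS d r s)
  have h2 := (Real.tendsto_one_add_div_pow_exp (-c)).pow (iS d r s)
  have h3 := (h1.mul h2).const_mul ((1 - hS d r s) / fS d r s)
  rw [wS_eq]
  convert h3 using 1
  · funext n
    rw [← pow_mul, neg_div, ← sub_eq_add_neg]
  · congr 1; ring

lemma expect_card (n d : ℕ) (p : ℝ) :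
    expectY n d p (fun F => (F.card : ℝ)) = p * n.choose (d + 1) := by
  have h : expectY n d p (fun F => (F.card : ℝ)) = expectY n d p (fun F =>
      ∑ σ ∈ allFaces n d, if {σ} ⊆ F ∧ Disjoint F ∅ then 1 else 0) := by
    unfold expectY
    refine Finset.sum_congr rfl fun F hF => ?_
    congr 1
    rw [Finset.mem_powerset] at hF
    simp only [Finset.singleton_subset_iff, Finset.disjoint_empty_right, and_true]
    rw [Finset.sum_boole, Finset.filter_mem_eq_inter, Finset.inter_eq_right.mpr hF]
  rw [h, expect_sum, Finset.sum_congr rfl fun σ hσ => expect_match n d p {σ} ∅ (by simpa using hσ)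
    (by simp) (by simp)]
  simp only [Finset.card_singleton, Finset.card_empty, pow_one, pow_zero, mul_one, Finset.sum_const,
    nsmul_eq_mul]
  have : (allFaces n d).card = n.choose (d + 1) := by
    have : allFaces n d = Finset.powersetCard (d + 1) Finset.univ := by
      ext σ; simp [allFaces, Finset.mem_powersetCard]
    rw [this, Finset.card_powersetCard]; simp
  rw [this, mul_comm]

lemma expect_sub (n d : ℕ) (p : ℝ) (X Y : Finset (Finset (Fin n)) → ℝ) :
    expectY n d p (fun F => X F - Y F) = expectY n d p X - expectY n d p Y := by
  unfold expectY
  rw [← Finset.sum_sub_distrib]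
  refine Finset.sum_congr rfl fun F _ => ?_
  ring

lemma exists_img {n d : ℕ} (τ : Finset (Fin n)) (h : τ.card = d) :
    ∃ x : Fin d → Fin n, Function.Injective x ∧ img x = τ := by
  refine ⟨fun i => τ.orderEmbOfFin h i, (τ.orderEmbOfFin h).injective, ?_⟩
  have := Finset.range_orderEmbOfFin τ h
  ext w
  rw [mem_img, ← Finset.mem_coe, ← this, Set.mem_range]

theorem upper {n d : ℕ} (hd : 1 ≤ d) (hn : d ≤ n) (p : ℝ) (hp0 : 0 ≤ p) (hp1 : p ≤ 1) (M r : ℕ) :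
    expectY n d p (fun F => (dimKer n F : ℝ)) / n.choose d ≤
      ((n - d : ℕ) : ℝ) * p / (d + 1) - ∑ s ∈ Box d M r, (1 - hS d r s) / fS d r s *
      ((n - d).descFactorial (eS d r s) * p ^ eS d r s * (1 - p) ^ (n * iS d r s)) := by
  set S := ∑ s ∈ Box d M r, (1 - hS d r s) / fS d r s *
      ((n - d).descFactorial (eS d r s) * p ^ eS d r s * (1 - p) ^ (n * iS d r s)) with hS
  have h1 := expect_mono n d p hp0 hp1 _ _ fun F _ => dimKer_le d F
  rw [expect_sub, expect_card, expect_sum] at h1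
  have h2 : (n.choose d : ℝ) * S ≤ ∑ τ ∈ Finset.powersetCard d (Finset.univ : Finset (Fin n)),
      expectY n d p (fun F => 1 - hF F τ) := by
    calc (n.choose d : ℝ) * S = ∑ τ ∈ Finset.powersetCard d (Finset.univ : Finset (Fin n)), S := by
          rw [Finset.sum_const, Finset.card_powersetCard]; simp
      _ ≤ _ := by
          refine Finset.sum_le_sum fun τ hτ => ?_
          obtain ⟨x, hx, rfl⟩ := exists_img τ (Finset.mem_powersetCard.mp hτ).2
          exact expect_lower hd p hp0 hp1 M r x hx
  have hC : (0 : ℝ) < n.choose d := by exact_mod_cast Nat.choose_pos hn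
  have h3 : (n.choose (d + 1) : ℝ) * (d + 1) = n.choose d * ((n - d : ℕ) : ℝ) := by
    exact_mod_cast Nat.choose_succ_right_eq n d
  rw [div_le_iff₀ hC]
  have h4 : (((n - d : ℕ) : ℝ) * p / (d + 1) - S) * n.choose d = p * n.choose (d + 1) - n.choose d * S := by
    have : ((d : ℝ) + 1) ≠ 0 := by positivity
    field_simp
    linear_combination (-p) * h3
  rw [h4]
  linarith

theorem main (d : ℕ) (hd : 2 ≤ d) (c td tc : ℝ)
    (htd : td ∈ Set.Ioo (0 : ℝ) 1)
    (hroot : ((d : ℝ) + 1) * (1 - td) + (1 + (d : ℝ) * td) * Real.log td = 0)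
    (hc : c > -Real.log td / (1 - td) ^ d)
    (htc : tc ∈ Set.Ioo (0 : ℝ) 1)
    (htcroot : tc = Real.exp (-c * (1 - tc) ^ d))
    (htcmin : ∀ t ∈ Set.Ioo (0 : ℝ) 1, t = Real.exp (-c * (1 - t) ^ d) → tc ≤ t) :
    Filter.limsup (fun n : ℕ =>
        expectY n d (c / n) (fun F => (dimKer n F : ℝ)) / (n.choose d)) Filter.atTop ≤
      c * tc * (1 - tc) ^ d + c / ((d : ℝ) + 1) * (1 - tc) ^ (d + 1) - (1 - tc) := by
  have hc0 : 0 ≤ c := by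
    have h1 : 0 < -Real.log td := by have := Real.log_neg htd.1 htd.2; linarith
    have h2 : 0 < 1 - td := by linarith [htd.2]
    have : 0 < -Real.log td / (1 - td) ^ d := by positivity
    linarith
  obtain ⟨t, ht0, ht1, ht, hE⟩ := limit_law d ⟨c, hc0⟩
  change t = Real.exp (-c * (1 - t) ^ d) at ht
  change (EE d ⟨c, hc0⟩).toReal = t - c / (d + 1) * (1 - (1 - t) ^ (d + 1)) + c * t * (1 - t) ^ d at hE
  have hgg := gg_le htd hroot hc htc htcroot htcmin ht0 ht1 ht
  refine le_trans ?_ hgg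
  have hev : ∀ᶠ n : ℕ in atTop, c / n ≤ 1 ∧ d ≤ n ∧ 0 ≤ c / n := by
    have := (tendsto_const_div_atTop_nhds_zero_nat c).eventually (Iic_mem_nhds (zero_lt_one))
    filter_upwards [this, eventually_ge_atTop d] with n h1 h2
    exact ⟨h1, h2, by positivity⟩
  refine le_of_forall_pos_le_add fun ε hε => ?_
  obtain ⟨r, M, hrM⟩ := box_approx d (by omega) ⟨c, hc0⟩ (1 - (EE d ⟨c, hc0⟩).toReal - ε) (by linarith)
  change 1 - (EE d ⟨c, hc0⟩).toReal - ε < ∑ s ∈ Box d M r, wS d c r s * (1 - hS d r s) at hrM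
  refine limsup_le_of_le ?_ ?_
  · refine IsCoboundedUnder.of_frequently_ge (a := 0) (Eventually.frequently ?_)
    filter_upwards [hev] with n hn
    refine div_nonneg ?_ (by positivity)
    have := expect_mono n d (c / n) hn.2.2 hn.1 (fun _ => 0) (fun F => (dimKer n F : ℝ))
      (fun F _ => by positivity)
    refine le_trans (le_of_eq ?_) this
    simp [expectY]
  · have hlim := ((tendsto_sub_div c d).div_const ((d : ℝ) + 1)).sub (tendsto_box d M r c)
    have hlt : c / ((d : ℝ) + 1) - ∑ s ∈ Box d M r, wS d c r s * (1 - hS d r s) < gg d c t + ε := by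
      have : c / ((d : ℝ) + 1) - (1 - (EE d ⟨c, hc0⟩).toReal) = gg d c t := by
        rw [hE, gg]; ring
      linarith
    filter_upwards [hev, hlim.eventually (gt_mem_nhds hlt)] with n hn h2
    exact (upper (by omega) hn.2.1 _ hn.2.2 hn.1 M r).trans h2.le

end LP

/-- For `d ≥ 2` and `c > c_d^*`, with `t_c` the smallest root in `(0,1)` of
`t = e^{-c(1-t)^d}`,
`limsup_n E[dim ker ∂_d(Y_d(n,c/n))]/C(n,d) ≤ c t_c (1-t_c)^d + c/(d+1)·(1-t_c)^{d+1} - (1-t_c)`. -/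
theorem statement6 (d : ℕ) (hd : 2 ≤ d) (c td tc : ℝ)
    (htd : td ∈ Set.Ioo (0 : ℝ) 1)
    (hroot : ((d : ℝ) + 1) * (1 - td) + (1 + (d : ℝ) * td) * Real.log td = 0)
    (hc : c > -Real.log td / (1 - td) ^ d)
    (htc : tc ∈ Set.Ioo (0 : ℝ) 1)
    (htcroot : tc = Real.exp (-c * (1 - tc) ^ d))
    (htcmin : ∀ t ∈ Set.Ioo (0 : ℝ) 1, t = Real.exp (-c * (1 - t) ^ d) → tc ≤ t) :
    Filter.limsup (fun n : ℕ =>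
        expectY n d (c / n) (fun F => (dimKer n F : ℝ)) / (n.choose d)) Filter.atTop ≤
      c * tc * (1 - tc) ^ d + c / ((d : ℝ) + 1) * (1 - tc) ^ (d + 1) - (1 - tc) := by
  exact LP.main d hd c td tc htd hroot hc htc htcroot htcmin

end
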